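/- arXiv:1012.4765 — 10 statements merged into one kernel-verified Lean document; each statement's English description precedes it below -/
import Mathlib

section
/- Let δ be a hemi-metric on a set X and let T : X → X be non-expansive with respect to δ. Then for every x ∈ X the limit lim_{k→∞} δ(x,T^k(x))/k exists and equals inf_{k≥1} δ(x,T^k(x))/k, and this limit is independent of the choice of x ∈ X. -/
open Filter Topology

/-- If `T` is non-expansive, then so are its iterates. -/
theorem iterate_nonexpansive {X : Type*} {δ : X → X → ℝ} {T : X → X}
    (hT : ∀ x y : X, δ (T x) (T y) ≤ δ x y) (n : ℕ) (x y : X) :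
    δ (T^[n] x) (T^[n] y) ≤ δ x y := by
  induction n with
  | zero => exact le_rfl
  | succ n ih =>
    rw [Function.iterate_succ_apply', Function.iterate_succ_apply']
    exact (hT _ _).trans ih

theorem subadditive_orbit {X : Type*} {δ : X → X → ℝ} {T : X → X}
    (htri : ∀ x y z : X, δ x z ≤ δ x y + δ y z)
    (hT : ∀ x y : X, δ (T x) (T y) ≤ δ x y) (x : X) :
    Subadditive fun k => δ x (T^[k] x) := by
  intro m n
  have h := iterate_nonexpansive hT m x (T^[n] x)
  rw [← Function.iterate_add_apply] at h
  linarith [htri x (T^[m] x) (T^[m + n] x)]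

theorem iterate_le_mul {X : Type*} {δ : X → X → ℝ} {T : X → X}
    (htri : ∀ x y z : X, δ x z ≤ δ x y + δ y z) (hself : ∀ x : X, δ x x = 0)
    (hT : ∀ x y : X, δ (T x) (T y) ≤ δ x y) (x : X) (k : ℕ) :
    δ (T^[k] x) x ≤ k * δ (T x) x := by
  induction k with
  | zero => simp [hself]
  | succ k ih =>
    have h := iterate_nonexpansive hT k (T x) x
    rw [← Function.iterate_succ_apply] at h
    push_cast
    linarith [htri (T^[k + 1] x) (T^[k] x) x]

theorem bddBelow_range_orbit_div {X : Type*} {δ : X → X → ℝ} {T : X → X}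
    (htri : ∀ x y z : X, δ x z ≤ δ x y + δ y z) (hself : ∀ x : X, δ x x = 0)
    (hT : ∀ x y : X, δ (T x) (T y) ≤ δ x y) (x : X) :
    BddBelow (Set.range fun k : ℕ => δ x (T^[k] x) / (k : ℝ)) := by
  refine ⟨-|δ (T x) x|, ?_⟩
  rintro _ ⟨k, rfl⟩
  rcases k.eq_zero_or_pos with rfl | hk
  · simp
  · have hk' : (0 : ℝ) < k := by exact_mod_cast hk
    have hle := iterate_le_mul htri hself hT x k
    have hx := htri x (T^[k] x) x
    rw [hself] at hx
    rw [le_div_iff₀ hk']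
    linarith [mul_le_mul_of_nonneg_left (le_abs_self (δ (T x) x)) hk'.le]

/-- The linear growth rates of two orbits of a non-expansive map are comparable. -/
theorem orbit_rate_le {X : Type*} {δ : X → X → ℝ} {T : X → X}
    (htri : ∀ x y z : X, δ x z ≤ δ x y + δ y z)
    (hT : ∀ x y : X, δ (T x) (T y) ≤ δ x y) {x y : X} {a b : ℝ}
    (ha : Tendsto (fun k : ℕ => δ x (T^[k] x) / (k : ℝ)) atTop (𝓝 a))
    (hb : Tendsto (fun k : ℕ => δ y (T^[k] y) / (k : ℝ)) atTop (𝓝 b)) : b ≤ a := by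
  have hC : Tendsto (fun k : ℕ => (δ y x + δ x y) / (k : ℝ)) atTop (𝓝 0) :=
    tendsto_const_nhds.div_atTop tendsto_natCast_atTop_atTop
  have hsum := ha.add hC
  rw [add_zero] at hsum
  refine le_of_tendsto_of_tendsto' hb hsum fun k => ?_
  rw [← add_div]
  refine div_le_div_of_nonneg_right ?_ k.cast_nonneg
  linarith [htri y x (T^[k] y), htri x (T^[k] x) (T^[k] y), iterate_nonexpansive hT k x y]

/-- The limit in Fekete's lemma as an infimum over positive indices. -/
theorem Subadditive.lim_eq_iInf {u : ℕ → ℝ} (h : Subadditive u)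
    (hbdd : BddBelow (Set.range fun n : ℕ => u n / n)) :
    h.lim = ⨅ k : ℕ, u (k + 1) / ((k : ℝ) + 1) := by
  have hle (k : ℕ) : h.lim ≤ u (k + 1) / ((k : ℝ) + 1) := by
    simpa using h.lim_le_div hbdd k.succ_ne_zero
  refine le_antisymm (le_ciInf hle) ?_
  refine ge_of_tendsto ((tendsto_add_atTop_iff_nat 1).2 (h.tendsto_lim hbdd))
    (Eventually.of_forall fun k => ?_)
  rw [Nat.cast_add_one]
  exact ciInf_le ⟨h.lim, Set.forall_mem_range.2 hle⟩ k

/-- For a non-expansive self-map `T` of a hemi-metric space `(X, δ)`,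
the limit `lim_k δ(x, T^k(x))/k` exists for every `x`, equals
`inf_{k ≥ 1} δ(x, T^k(x))/k`, and is independent of the choice of `x`. -/
theorem escape_rate_exists {X : Type*} (δ : X → X → ℝ)
    (htri : ∀ x y z : X, δ x z ≤ δ x y + δ y z)
    (hsep : ∀ x y : X, (δ x y = 0 ∧ δ y x = 0) ↔ x = y)
    (T : X → X) (hT : ∀ x y : X, δ (T x) (T y) ≤ δ x y) :
    ∃ ρ : ℝ, ∀ x : X,
      Tendsto (fun k : ℕ => δ x (T^[k] x) / (k : ℝ)) atTop (𝓝 ρ) ∧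
      ρ = ⨅ k : ℕ, δ x (T^[k + 1] x) / ((k : ℝ) + 1) := by
  have hself (x : X) : δ x x = 0 := ((hsep x x).2 rfl).1
  have hbdd := bddBelow_range_orbit_div htri hself hT
  have hsub := subadditive_orbit htri hT
  have hlim (x : X) := (hsub x).tendsto_lim (hbdd x)
  rcases isEmpty_or_nonempty X with _ | ⟨⟨x₀⟩⟩
  · exact ⟨0, isEmptyElim⟩
  · refine ⟨(hsub x₀).lim, fun x => ?_⟩
    have heq : (hsub x₀).lim = (hsub x).lim :=
      le_antisymm (orbit_rate_le htri hT (hlim x) (hlim x₀))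
        (orbit_rate_le htri hT (hlim x₀) (hlim x))
    rw [heq]
    exact ⟨hlim x, (hsub x).lim_eq_iInf (hbdd x)⟩
end

section
/- Let (X,δ) be a complete metrically star-shaped hemi-metric space and let T : X → X be non-expansive with respect to δ. Then there exists a Martin function h ∈ 𝓜 such that h(T(x)) ≥ h(x) + ρ̄(T) for all x ∈ X. Moreover, if δ is bounded from below (i.e. inf_{x,y} δ(x,y) > −∞) and ρ̄(T) > 0, then any such h is necessarily a horofunction, i.e. h ≠ i(z) for every z ∈ X. -/
open Filter Topology

/-- A map that does not increase `δ` satisfies `-δ (T x) x ≤ δ y (T y)` for all `x` and `y`. -/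
theorem neg_displacement_le_displacement {X : Type*} (δ : X → X → ℝ)
    (htri : ∀ x y z : X, δ x z ≤ δ x y + δ y z) (hself : ∀ x : X, δ x x = 0)
    (T : X → X) (hT : ∀ x y : X, δ (T x) (T y) ≤ δ x y) (x y : X) :
    -δ (T x) x ≤ δ y (T y) := by
  have hiter : ∀ (n : ℕ) (u v : X), δ (T^[n] u) (T^[n] v) ≤ δ u v := by
    intro n
    induction n with
    | zero => intro u v; simp
    | succ n ih => intro u v; exact (ih (T u) (T v)).trans (hT u v)
  have hfwd : ∀ n : ℕ, δ y (T^[n] y) ≤ n * δ y (T y) := by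
    intro n
    induction n with
    | zero => simp [hself]
    | succ n ih =>
      have h₁ := htri y (T^[n] y) (T^[n + 1] y)
      have h₂ : δ (T^[n] y) (T^[n + 1] y) ≤ δ y (T y) := hiter n y (T y)
      push_cast
      linarith
  have hbwd : ∀ n : ℕ, δ (T^[n] x) x ≤ n * δ (T x) x := by
    intro n
    induction n with
    | zero => simp [hself]
    | succ n ih =>
      have h₁ := htri (T^[n + 1] x) (T^[n] x) x
      have h₂ : δ (T^[n + 1] x) (T^[n] x) ≤ δ (T x) x := hiter n (T x) x
      push_cast
      linarith
  by_contra! hlt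
  obtain ⟨n, hn⟩ := exists_nat_gt ((δ x y + δ y x) / (-δ (T x) x - δ y (T y)))
  rw [div_lt_iff₀ (by linarith)] at hn
  have h₀ := htri x (T^[n] x) x
  have h₁ := htri x y (T^[n] x)
  have h₂ := htri y (T^[n] y) (T^[n] x)
  have h₃ := hiter n y x
  have h₄ := hfwd n
  have h₅ := hbwd n
  rw [hself] at h₀
  linarith

/-- The functions `y ↦ δ b z - δ y z` lie in a common compact set. -/
theorem exists_isCompact_forall_martin_mem {X : Type*} (δ : X → X → ℝ)
    (htri : ∀ x y z : X, δ x z ≤ δ x y + δ y z) (b : X) :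
    ∃ K : Set (X → ℝ), IsCompact K ∧ ∀ z : X, (fun y => δ b z - δ y z) ∈ K := by
  refine ⟨Set.univ.pi fun y => Set.Icc (-δ y b) (δ b y),
    isCompact_univ_pi fun y => isCompact_Icc, fun z y _ => ⟨?_, ?_⟩⟩
  · linarith [htri y b z]
  · linarith [htri b y z]

/-- Let `(X, δ)` be a complete metrically star-shaped hemi-metric space
and `T : X → X` non-expansive. Then there is a Martin function `h` (an element of the
closure, for pointwise convergence, of the functions `i(z) : y ↦ δ(b,z) − δ(y,z)`)
such that `h(T(x)) ≥ h(x) + ρ̄(T)` for all `x`, where `ρ̄(T) = inf_y δ(y, T(y))`.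
Moreover, if `δ` is bounded from below and `ρ̄(T) > 0`, then any such `h` is a
horofunction, i.e. `h ≠ i(z)` for every `z ∈ X`. -/
theorem main_theorem_martin_function {X : Type*} [MetricSpace X] [CompleteSpace X]
    (δ : X → X → ℝ)
    (htri : ∀ x y z : X, δ x z ≤ δ x y + δ y z)
    (hsep : ∀ x y : X, (δ x y = 0 ∧ δ y x = 0) ↔ x = y)
    (hdist : ∀ x y : X, dist x y = max (δ x y) (δ y x))
    -- metrically star-shaped with centre `x₀` and geodesics `γ`
    (x₀ : X) (γ : X → ℝ → X)
    (hγ0 : ∀ y : X, γ y 0 = x₀)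
    (hγ1 : ∀ y : X, γ y 1 = y)
    (hgeo : ∀ (y : X) (s t : ℝ), 0 ≤ s → s ≤ t → t ≤ 1 →
      δ (γ y s) (γ y t) = (t - s) * δ x₀ y)
    (hconv : ∀ (y z : X) (s : ℝ), 0 ≤ s → s ≤ 1 → δ (γ y s) (γ z s) ≤ s * δ y z)
    (hend : ∀ y : X, Tendsto (fun s : ℝ => δ y (γ y s)) (𝓝[<] (1 : ℝ)) (𝓝 0))
    (T : X → X) (hT : ∀ x y : X, δ (T x) (T y) ≤ δ x y)
    (b : X) :
    (∃ h ∈ closure {f : X → ℝ | ∃ z : X, f = fun y => δ b z - δ y z},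
        ∀ x : X, h (T x) ≥ h x + ⨅ y : X, δ y (T y)) ∧
    ((∃ c : ℝ, ∀ x y : X, c ≤ δ x y) → (0 < ⨅ y : X, δ y (T y)) →
      ∀ h ∈ closure {f : X → ℝ | ∃ z : X, f = fun y => δ b z - δ y z},
        (∀ x : X, h (T x) ≥ h x + ⨅ y : X, δ y (T y)) →
        ∀ z : X, h ≠ fun y => δ b z - δ y z) := by
  have hself : ∀ x : X, δ x x = 0 := fun x => ((hsep x x).2 rfl).1
  have hinf : ∀ y : X, (⨅ y : X, δ y (T y)) ≤ δ y (T y) := ciInf_le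
    ⟨-δ (T b) b, by
      rintro _ ⟨y, rfl⟩
      exact neg_displacement_le_displacement δ htri hself T hT b y⟩
  set ρ := ⨅ y : X, δ y (T y)
  constructor
  · have hfix : ∀ s : ℝ, ∃ y : X, s ∈ Set.Ioo (0 : ℝ) 1 → γ (T y) s = y := by
      intro s
      by_cases hs : s ∈ Set.Ioo (0 : ℝ) 1
      · have hcontr : ContractingWith ⟨s, hs.1.le⟩ fun y => γ (T y) s := by
          refine ⟨hs.2, LipschitzWith.of_dist_le_mul fun u v => ?_⟩
          have hle : ∀ u v : X, δ (γ (T u) s) (γ (T v) s) ≤ s * δ u v := fun u v =>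
            (hconv _ _ s hs.1.le hs.2.le).trans (mul_le_mul_of_nonneg_left (hT u v) hs.1.le)
          change dist _ _ ≤ s * dist u v
          rw [hdist, hdist u v]
          exact max_le ((hle u v).trans (mul_le_mul_of_nonneg_left (le_max_left _ _) hs.1.le))
            ((hle v u).trans (mul_le_mul_of_nonneg_left (le_max_right _ _) hs.1.le))
        have : Nonempty X := ⟨b⟩
        exact ⟨ContractingWith.fixedPoint _ hcontr, fun _ => hcontr.fixedPoint_isFixedPt⟩
      · exact ⟨b, fun h => absurd h hs⟩
    choose p hp using hfix
    obtain ⟨K, hK, hmem⟩ := exists_isCompact_forall_martin_mem δ htri b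
    let i : X → X → ℝ := fun z y => δ b z - δ y z
    let U : Ultrafilter ℝ := Ultrafilter.of (𝓝[<] (1 : ℝ))
    have hU : (U : Filter ℝ) ≤ 𝓝[<] (1 : ℝ) := Ultrafilter.of_le _
    obtain ⟨h, -, hlim⟩ := hK.ultrafilter_le_nhds (U.map fun s => i (p s))
      (le_principal_iff.2 (mem_map.2 (Eventually.of_forall fun s => hmem (p s))))
    replace hlim : Tendsto (fun s => i (p s)) U (𝓝 h) := hlim
    refine ⟨h, mem_closure_of_tendsto hlim (Eventually.of_forall fun s => ⟨p s, rfl⟩),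
      fun x => ?_⟩
    have hdiff : Tendsto (fun s => i (p s) (T x) - i (p s) x) U (𝓝 (h (T x) - h x)) :=
      (tendsto_pi_nhds.1 hlim (T x)).sub (tendsto_pi_nhds.1 hlim x)
    have hbound : Tendsto (fun s : ℝ => s * ρ - (1 - s) * δ x₀ x - δ (T x) (γ (T x) s)) U
        (𝓝 ρ) := by
      have hid : Tendsto (fun s : ℝ => s) (𝓝[<] (1 : ℝ)) (𝓝 1) := nhdsWithin_le_nhds
      have := ((hid.mul_const ρ).sub ((hid.const_sub 1).mul_const (δ x₀ x))).sub (hend (T x))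
      simpa using this.mono_left hU
    have hle : ∀ᶠ s in (U : Filter ℝ),
        s * ρ - (1 - s) * δ x₀ x - δ (T x) (γ (T x) s) ≤ i (p s) (T x) - i (p s) x := by
      filter_upwards [hU (Ioo_mem_nhdsLT (zero_lt_one' ℝ))] with s hs
      have hfp := hp s hs
      have hfrom : δ x₀ (p s) = s * δ x₀ (T (p s)) := by
        simpa [hγ0, hfp] using hgeo (T (p s)) 0 s le_rfl hs.1.le hs.2.le
      have hto : δ (p s) (T (p s)) = (1 - s) * δ x₀ (T (p s)) := by
        simpa [hγ1, hfp] using hgeo (T (p s)) s 1 hs.1.le hs.2.le le_rfl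
      have hρ : s * ρ ≤ (1 - s) * δ x₀ (p s) := by
        calc s * ρ ≤ s * δ (p s) (T (p s)) := mul_le_mul_of_nonneg_left (hinf _) hs.1.le
          _ = (1 - s) * δ x₀ (p s) := by rw [hto, hfrom]; ring
      have hx := mul_le_mul_of_nonneg_left (htri x₀ x (p s)) (sub_nonneg.2 hs.2.le)
      have hcon := hconv (T x) (T (p s)) s hs.1.le hs.2.le
      rw [hfp] at hcon
      have hTx := mul_le_mul_of_nonneg_left (hT x (p s)) hs.1.le
      have htr := htri (T x) (γ (T x) s) (p s)
      simp only [i]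
      linarith
    linarith [le_of_tendsto_of_tendsto hbound hdiff hle]
  · rintro ⟨c, hc⟩ hpos h - hT' z rfl
    have hiter : ∀ n : ℕ, δ (T^[n] z) z ≤ -(n * ρ) := by
      intro n
      induction n with
      | zero => simp [hself]
      | succ n ih =>
        have := hT' (T^[n] z)
        rw [Function.iterate_succ_apply']
        push_cast
        linarith
    obtain ⟨n, hn⟩ := exists_nat_gt (-c / ρ)
    rw [div_lt_iff₀ hpos] at hn
    linarith [hiter n, hc (T^[n] z) z]
end

section
/- Let (X,δ) be a complete metrically star-shaped hemi-metric space and let T : X → X be non-expansive with respect to δ. Then there exists a Martin function h ∈ 𝓜, independent of x, such that h(T^k(x)) ≥ h(x) + k·ρ̄(T) for all x ∈ X and all k ∈ ℕ. -/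
open Filter Topology

namespace HemiMetric

variable {X : Type*} [MetricSpace X] {δ : X → X → ℝ}

/-- A non-expansive map has displacement bounded below by minus the displacement of any point. -/
theorem neg_dist_le_displacement
    (htri : ∀ x y z : X, δ x z ≤ δ x y + δ y z) (hself : ∀ x : X, δ x x = 0)
    (hdist : ∀ x y : X, dist x y = max (δ x y) (δ y x))
    {T : X → X} (hT : ∀ x y : X, δ (T x) (T y) ≤ δ x y) (x y : X) :
    -dist x (T x) ≤ δ y (T y) := by
  have hle : ∀ u v : X, δ u v ≤ dist u v := fun u v => hdist u v ▸ le_max_left _ _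
  have horbit : ∀ (k : ℕ) (u v : X), δ (T^[k] u) (T^[k] v) ≤ δ u v := by
    intro k
    induction k with
    | zero => intro u v; simp
    | succ k ih =>
      intro u v
      simpa only [Function.iterate_succ_apply] using (ih (T u) (T v)).trans (hT u v)
  have hforward : ∀ k : ℕ, δ y (T^[k] y) ≤ k * δ y (T y) := by
    intro k
    induction k with
    | zero => simp [hself]
    | succ k ih =>
      have h1 := htri y (T^[k] y) (T^[k + 1] y)
      have h2 := horbit k y (T y)
      rw [← Function.iterate_succ_apply] at h2
      push_cast
      linarith
  have hback : ∀ k : ℕ, δ (T^[k] x) x ≤ k * dist x (T x) := by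
    intro k
    induction k with
    | zero => simp [hself]
    | succ k ih =>
      have h1 := htri (T^[k + 1] x) (T^[k] x) x
      have h2 := horbit k (T x) x
      rw [← Function.iterate_succ_apply] at h2
      have h3 := hle (T x) x
      rw [dist_comm] at h3
      push_cast
      linarith
  have hbound : ∀ k : ℕ, (k : ℝ) * (-dist x (T x) - δ y (T y)) ≤ δ x y + δ y x := by
    intro k
    have h1 := htri x (T^[k] x) x
    have h2 := htri x y (T^[k] x)
    have h3 := htri y (T^[k] y) (T^[k] x)
    have h4 := horbit k y x
    have h5 := hforward k
    have h6 := hback k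
    rw [hself] at h1
    linarith
  by_contra! hlt
  obtain ⟨k, hk⟩ := exists_nat_gt ((δ x y + δ y x) / (-dist x (T x) - δ y (T y)))
  rw [div_lt_iff₀ (by linarith)] at hk
  exact absurd (hbound k) (not_le.mpr hk)

/-- A map that is an `s`-contraction for the hemi-metric, with `0 ≤ s < 1`, has a fixed point. -/
theorem exists_fixedPoint_of_contraction [CompleteSpace X] [Nonempty X]
    (hdist : ∀ x y : X, dist x y = max (δ x y) (δ y x))
    {F : X → X} {s : ℝ} (hs0 : 0 ≤ s) (hs1 : s < 1)
    (hF : ∀ x y : X, δ (F x) (F y) ≤ s * δ x y) : ∃ y, F y = y := by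
  have hcontr : ContractingWith ⟨s, hs0⟩ F := by
    refine ⟨by exact_mod_cast hs1, LipschitzWith.of_dist_le_mul fun x y => ?_⟩
    change dist (F x) (F y) ≤ s * dist x y
    rw [hdist, hdist, mul_max_of_nonneg _ _ hs0]
    exact max_le_max (hF x y) (hF y x)
  exact ⟨_, hcontr.fixedPoint_isFixedPt⟩

/-- Along any ultrafilter, the functions `y ↦ δ b (z s) - δ y (z s)` converge pointwise. -/
theorem exists_tendsto_ultrafilter {X ι : Type*} {δ : X → X → ℝ}
    (htri : ∀ x y z : X, δ x z ≤ δ x y + δ y z)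
    (b : X) (z : ι → X) (U : Ultrafilter ι) :
    ∃ h : X → ℝ, Tendsto (fun s y => δ b (z s) - δ y (z s)) U (𝓝 h) := by
  have hpoint : ∀ y : X, ∃ l : ℝ, Tendsto (fun s => δ b (z s) - δ y (z s)) U (𝓝 l) := by
    intro y
    have hmem : ∀ s, δ b (z s) - δ y (z s) ∈ Set.Icc (-δ y b) (δ b y) := fun s =>
      ⟨by linarith [htri y b (z s)], by linarith [htri b y (z s)]⟩
    obtain ⟨l, -, hl⟩ := isCompact_Icc.ultrafilter_le_nhds
      (U.map fun s => δ b (z s) - δ y (z s))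
      (tendsto_principal.mpr (Eventually.of_forall hmem))
    exact ⟨l, hl⟩
  choose h hh using hpoint
  exact ⟨h, tendsto_pi_nhds.mpr hh⟩

end HemiMetric

/-- Let `(X, δ)` be a complete metrically star-shaped hemi-metric space
and `T : X → X` non-expansive. Then there is a Martin function `h` (an element of the
closure, for pointwise convergence, of the functions `i(z) : y ↦ δ(b,z) − δ(y,z)`),
independent of `x`, such that `h(T^k(x)) ≥ h(x) + k·ρ̄(T)` for all `x ∈ X` and `k ∈ ℕ`,
where `ρ̄(T) = inf_y δ(y, T(y))`. -/
theorem martin_function_pumping {X : Type*} [MetricSpace X] [CompleteSpace X]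
    (δ : X → X → ℝ)
    (htri : ∀ x y z : X, δ x z ≤ δ x y + δ y z)
    (hsep : ∀ x y : X, (δ x y = 0 ∧ δ y x = 0) ↔ x = y)
    (hdist : ∀ x y : X, dist x y = max (δ x y) (δ y x))
    (x₀ : X) (γ : X → ℝ → X)
    (hγ0 : ∀ y : X, γ y 0 = x₀)
    (hγ1 : ∀ y : X, γ y 1 = y)
    (hgeo : ∀ (y : X) (s t : ℝ), 0 ≤ s → s ≤ t → t ≤ 1 →
      δ (γ y s) (γ y t) = (t - s) * δ x₀ y)
    (hconv : ∀ (y z : X) (s : ℝ), 0 ≤ s → s ≤ 1 → δ (γ y s) (γ z s) ≤ s * δ y z)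
    (hend : ∀ y : X, Tendsto (fun s : ℝ => δ y (γ y s)) (𝓝[<] (1 : ℝ)) (𝓝 0))
    (T : X → X) (hT : ∀ x y : X, δ (T x) (T y) ≤ δ x y)
    (b : X) :
    ∃ h ∈ closure {f : X → ℝ | ∃ z : X, f = fun y => δ b z - δ y z},
      ∀ (x : X) (k : ℕ), h (T^[k] x) ≥ h x + (k : ℝ) * ⨅ y : X, δ y (T y) := by
  have hself : ∀ x : X, δ x x = 0 := fun x => ((hsep x x).mpr rfl).1
  set ρ := ⨅ y : X, δ y (T y)
  have hρle : ∀ y, ρ ≤ δ y (T y) := fun y => ciInf_le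
    ⟨-dist b (T b), Set.forall_mem_range.mpr fun y =>
      HemiMetric.neg_dist_le_displacement htri hself hdist hT b y⟩ y
  have : Nonempty X := ⟨b⟩
  have hfix : ∀ s : ℝ, ∃ z : X, 0 ≤ s → s < 1 → γ (T z) s = z := by
    intro s
    by_cases hs : 0 ≤ s ∧ s < 1
    · obtain ⟨z, hz⟩ := HemiMetric.exists_fixedPoint_of_contraction hdist hs.1 hs.2
        (F := fun x => γ (T x) s) fun x y => (hconv _ _ s hs.1 hs.2.le).trans
          (mul_le_mul_of_nonneg_left (hT x y) hs.1)
      exact ⟨z, fun _ _ => hz⟩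
    · exact ⟨b, fun h0 h1 => absurd ⟨h0, h1⟩ hs⟩
  choose z hz using hfix
  have hineq : ∀ (x : X) (s : ℝ), 0 ≤ s → s < 1 →
      (δ b (z s) - δ x (z s)) + (s * ρ - (1 - s) * δ x₀ x - δ (T x) (γ (T x) s))
        ≤ δ b (z s) - δ (T x) (z s) := by
    intro x s hs0 hs1
    have hzs := hz s hs0 hs1
    have h1 := htri (T x) (γ (T x) s) (z s)
    have h2 : δ (γ (T x) s) (z s) ≤ s * δ x (z s) := by
      have := (hconv (T x) (T (z s)) s hs0 hs1.le).trans
        (mul_le_mul_of_nonneg_left (hT x (z s)) hs0)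
      rwa [hzs] at this
    have h3 : δ x₀ (z s) = s * δ x₀ (T (z s)) := by
      have := hgeo (T (z s)) 0 s le_rfl hs0 hs1.le
      rwa [hγ0, hzs, sub_zero] at this
    have h4 : δ (z s) (T (z s)) = (1 - s) * δ x₀ (T (z s)) := by
      have := hgeo (T (z s)) s 1 hs0 hs1.le le_rfl
      rwa [hγ1, hzs] at this
    have h5 : s * ρ ≤ (1 - s) * δ x₀ (z s) := by
      calc s * ρ ≤ s * δ (z s) (T (z s)) := mul_le_mul_of_nonneg_left (hρle _) hs0
        _ = (1 - s) * δ x₀ (z s) := by rw [h3, h4]; ring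
    have h6 := mul_le_mul_of_nonneg_left (htri x₀ x (z s)) (sub_nonneg.mpr hs1.le)
    linarith
  let U : Ultrafilter ℝ := Ultrafilter.of (𝓝[<] (1 : ℝ))
  have hU : (U : Filter ℝ) ≤ 𝓝[<] (1 : ℝ) := Ultrafilter.of_le _
  obtain ⟨h, hlim⟩ := HemiMetric.exists_tendsto_ultrafilter htri b z U
  refine ⟨h, mem_closure_of_tendsto hlim (Eventually.of_forall fun s => ⟨z s, rfl⟩), ?_⟩
  rw [tendsto_pi_nhds] at hlim
  have hstep : ∀ x, h x + ρ ≤ h (T x) := by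
    intro x
    have hid : Tendsto (fun s : ℝ => s) U (𝓝 1) := hU.trans nhdsWithin_le_nhds
    have herr : Tendsto (fun s => s * ρ - (1 - s) * δ x₀ x - δ (T x) (γ (T x) s)) U (𝓝 ρ) := by
      simpa using ((hid.mul_const ρ).sub ((hid.const_sub 1).mul_const (δ x₀ x))).sub
        ((hend (T x)).mono_left hU)
    have hev : ∀ᶠ s in (U : Filter ℝ), s ∈ Set.Ioo (0 : ℝ) 1 :=
      hU (Ioo_mem_nhdsLT zero_lt_one)
    exact le_of_tendsto_of_tendsto ((hlim x).add herr) (hlim (T x))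
      (hev.mono fun s hs => hineq x s hs.1.le hs.2)
  intro x k
  induction k with
  | zero => simp
  | succ k ih =>
    have := hstep (T^[k] x)
    rw [Function.iterate_succ_apply']
    push_cast
    linarith
end

section
/- Let (X,δ) be a complete metrically star-shaped hemi-metric space and let T : X → X be non-expansive with respect to δ. Then ρ̄(T) = ρ(T), i.e. inf_{y∈X} δ(y,T(y)) = lim_{k→∞} δ(x,T^k(x))/k for every x ∈ X. -/
open Filter Topology

section HemiMetric

variable {X : Type*} {δ : X → X → ℝ} {T : X → X}

theorem hemimetric_self_iterate_le (htri : ∀ x y z : X, δ x z ≤ δ x y + δ y z)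
    (hself : ∀ x : X, δ x x = 0) (hT : ∀ x y : X, δ (T x) (T y) ≤ δ x y) (y : X) (k : ℕ) :
    δ y (T^[k] y) ≤ k * δ y (T y) := by
  induction k with
  | zero => simp [hself]
  | succ k ih =>
    have h1 := htri y (T y) (T^[k + 1] y)
    rw [Function.iterate_succ_apply'] at h1 ⊢
    have h2 := hT y (T^[k] y)
    push_cast
    linarith

theorem hemimetric_iterate_self_le (htri : ∀ x y z : X, δ x z ≤ δ x y + δ y z)
    (hself : ∀ x : X, δ x x = 0) (hT : ∀ x y : X, δ (T x) (T y) ≤ δ x y) (y : X) (k : ℕ) :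
    δ (T^[k] y) y ≤ k * δ (T y) y :=
  hemimetric_self_iterate_le (δ := fun a b => δ b a)
    (fun x y z => by linarith [htri z y x]) hself (fun x y => hT y x) y k

theorem hemimetric_iterate_le (hT : ∀ x y : X, δ (T x) (T y) ≤ δ x y) (x y : X) (k : ℕ) :
    δ (T^[k] x) (T^[k] y) ≤ δ x y := by
  induction k with
  | zero => simp
  | succ k ih =>
    simp only [Function.iterate_succ_apply']
    exact (hT _ _).trans ih

theorem hemimetric_self_iterate_le_add (htri : ∀ x y z : X, δ x z ≤ δ x y + δ y z)
    (hself : ∀ x : X, δ x x = 0) (hT : ∀ x y : X, δ (T x) (T y) ≤ δ x y) (x y : X) (k : ℕ) :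
    δ x (T^[k] x) ≤ k * δ y (T y) + (δ x y + δ y x) := by
  linarith [htri x y (T^[k] x), htri y (T^[k] y) (T^[k] x), hemimetric_iterate_le hT y x k,
    hemimetric_self_iterate_le htri hself hT y k]

theorem hemimetric_neg_le_displacement (htri : ∀ x y z : X, δ x z ≤ δ x y + δ y z)
    (hself : ∀ x : X, δ x x = 0) (hT : ∀ x y : X, δ (T x) (T y) ≤ δ x y) (x y : X) :
    -δ (T x) x ≤ δ y (T y) := by
  by_contra! h
  obtain ⟨k, hk⟩ := exists_nat_gt ((δ x y + δ y x) / (-δ (T x) x - δ y (T y)))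
  rw [div_lt_iff₀ (by linarith)] at hk
  linarith [htri x (T^[k] x) x, hself x, hemimetric_iterate_self_le htri hself hT x k,
    hemimetric_self_iterate_le_add htri hself hT x y k]

/-- The maps `y ↦ γ (T y) s` with `0 ≤ s < 1` are contractions, hence have fixed points. -/
theorem exists_fixedPoint_of_star_shaped [MetricSpace X] [CompleteSpace X]
    (hdist : ∀ x y : X, dist x y = max (δ x y) (δ y x)) (x₀ : X) (γ : X → ℝ → X)
    (hconv : ∀ (y z : X) (s : ℝ), 0 ≤ s → s ≤ 1 → δ (γ y s) (γ z s) ≤ s * δ y z)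
    (hT : ∀ x y : X, δ (T x) (T y) ≤ δ x y) {s : ℝ} (hs0 : 0 ≤ s) (hs1 : s < 1) :
    ∃ y, γ (T y) s = y := by
  have hle (y z : X) : δ (γ (T y) s) (γ (T z) s) ≤ s * δ y z :=
    (hconv _ _ s hs0 hs1.le).trans (mul_le_mul_of_nonneg_left (hT y z) hs0)
  have hlip : LipschitzWith ⟨s, hs0⟩ fun y => γ (T y) s := by
    refine LipschitzWith.of_dist_le_mul fun y z => ?_
    rw [hdist, hdist]
    change _ ≤ s * _
    rw [mul_max_of_nonneg _ _ hs0]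
    exact max_le_max (hle y z) (hle z y)
  have hc : ContractingWith ⟨s, hs0⟩ fun y => γ (T y) s := ⟨hs1, hlip⟩
  have : Nonempty X := ⟨x₀⟩
  exact ⟨_, hc.fixedPoint_isFixedPt⟩

/-- A lower bound of the displacement is a lower bound of the mean speed along every orbit. -/
theorem mul_le_self_iterate_of_star_shaped [MetricSpace X] [CompleteSpace X]
    (htri : ∀ x y z : X, δ x z ≤ δ x y + δ y z)
    (hdist : ∀ x y : X, dist x y = max (δ x y) (δ y x)) (x₀ : X) (γ : X → ℝ → X)
    (hγ1 : ∀ y : X, γ y 1 = y)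
    (hgeo : ∀ (y : X) (s t : ℝ), 0 ≤ s → s ≤ t → t ≤ 1 →
      δ (γ y s) (γ y t) = (t - s) * δ x₀ y)
    (hconv : ∀ (y z : X) (s : ℝ), 0 ≤ s → s ≤ 1 → δ (γ y s) (γ z s) ≤ s * δ y z)
    (hend : ∀ y : X, Tendsto (fun s : ℝ => δ y (γ y s)) (𝓝[<] (1 : ℝ)) (𝓝 0))
    (hT : ∀ x y : X, δ (T x) (T y) ≤ δ x y) {r : ℝ} (hr : ∀ y, r ≤ δ y (T y)) (x : X) (k : ℕ) :
    k * r ≤ δ x (T^[k] x) := by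
  let ε : ℝ → ℝ := fun s =>
    ∑ j ∈ Finset.range k, (δ (T^[j] x) (γ (T^[j] x) s) + (1 - s) * δ x₀ (T^[j] x))
  have hε : Tendsto ε (𝓝[<] 1) (𝓝 0) := by
    have h1 : Tendsto (fun s : ℝ => 1 - s) (𝓝[<] 1) (𝓝 0) := by
      have : Tendsto (fun s : ℝ => 1 - s) (𝓝 1) (𝓝 (1 - 1)) := by
        exact (continuous_const.sub continuous_id).tendsto 1
      rw [sub_self] at this
      exact this.mono_left nhdsWithin_le_nhds
    have := tendsto_finsetSum (Finset.range k) fun j _ =>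
      (hend (T^[j] x)).add (h1.mul_const (δ x₀ (T^[j] x)))
    simpa [ε] using this
  have hε' : Tendsto (fun s => δ x (T^[k] x) + ε s) (𝓝[<] 1) (𝓝 (δ x (T^[k] x))) := by
    simpa using hε.const_add (δ x (T^[k] x))
  refine ge_of_tendsto hε' ?_
  filter_upwards [Ioo_mem_nhdsLT (zero_lt_one' ℝ)] with s ⟨hs0, hs1⟩
  obtain ⟨y, hy⟩ := exists_fixedPoint_of_star_shaped hdist x₀ γ hconv hT hs0.le hs1
  have hdisp : δ y (T y) = (1 - s) * δ x₀ (T y) := by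
    have := hgeo (T y) s 1 hs0.le hs1.le le_rfl
    rwa [hγ1, hy] at this
  have hstep (z : X) :
      δ (T z) (T y) ≤ δ z (T y) - r + (δ z (γ z s) + (1 - s) * δ x₀ z) := by
    have h1 := hT z y
    have h2 := htri z (γ z s) y
    have h3 := hconv z (T y) s hs0.le hs1.le
    rw [hy] at h3
    have h4 := mul_le_mul_of_nonneg_left (htri x₀ z (T y)) (sub_nonneg.2 hs1.le)
    linarith [hr y]
  have hiter (n : ℕ) : δ (T^[n] x) (T y) ≤ δ x (T y) - n * r +
      ∑ j ∈ Finset.range n, (δ (T^[j] x) (γ (T^[j] x) s) + (1 - s) * δ x₀ (T^[j] x)) := by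
    induction n with
    | zero => simp
    | succ n ih =>
      rw [Function.iterate_succ_apply', Finset.sum_range_succ]
      push_cast
      linarith [hstep (T^[n] x)]
  linarith [hiter k, htri x (T^[k] x) (T y)]

end HemiMetric

/-- Let `(X, δ)` be a complete metrically star-shaped hemi-metric space
and `T : X → X` non-expansive. Then `ρ̄(T) = ρ(T)`, i.e. for every `x ∈ X`,
`δ(x, T^k(x))/k` tends to `inf_{y ∈ X} δ(y, T(y))` as `k → ∞`. -/
theorem escape_rate_eq_inf_displacement {X : Type*} [MetricSpace X] [CompleteSpace X]
    (δ : X → X → ℝ)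
    (htri : ∀ x y z : X, δ x z ≤ δ x y + δ y z)
    (hsep : ∀ x y : X, (δ x y = 0 ∧ δ y x = 0) ↔ x = y)
    (hdist : ∀ x y : X, dist x y = max (δ x y) (δ y x))
    (x₀ : X) (γ : X → ℝ → X)
    (hγ0 : ∀ y : X, γ y 0 = x₀)
    (hγ1 : ∀ y : X, γ y 1 = y)
    (hgeo : ∀ (y : X) (s t : ℝ), 0 ≤ s → s ≤ t → t ≤ 1 →
      δ (γ y s) (γ y t) = (t - s) * δ x₀ y)
    (hconv : ∀ (y z : X) (s : ℝ), 0 ≤ s → s ≤ 1 → δ (γ y s) (γ z s) ≤ s * δ y z)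
    (hend : ∀ y : X, Tendsto (fun s : ℝ => δ y (γ y s)) (𝓝[<] (1 : ℝ)) (𝓝 0))
    (T : X → X) (hT : ∀ x y : X, δ (T x) (T y) ≤ δ x y) :
    ∀ x : X, Tendsto (fun k : ℕ => δ x (T^[k] x) / (k : ℝ)) atTop
      (𝓝 (⨅ y : X, δ y (T y))) := by
  intro x
  have hself (y : X) : δ y y = 0 := ((hsep y y).2 rfl).1
  have hbdd : BddBelow (Set.range fun y => δ y (T y)) :=
    ⟨-δ (T x) x, by rintro _ ⟨y, rfl⟩; exact hemimetric_neg_le_displacement htri hself hT x y⟩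
  have : Nonempty X := ⟨x⟩
  have hlow (k : ℕ) : k * (⨅ y : X, δ y (T y)) ≤ δ x (T^[k] x) :=
    mul_le_self_iterate_of_star_shaped htri hdist x₀ γ hγ1 hgeo hconv hend hT
      (fun y => ciInf_le hbdd y) x k
  rw [tendsto_order]
  refine ⟨fun a ha => ?_, fun b hb => ?_⟩
  · filter_upwards [eventually_gt_atTop 0] with k hk
    have hk' : (0 : ℝ) < k := Nat.cast_pos.2 hk
    refine ha.trans_le ((le_div_iff₀ hk').2 ?_)
    linarith [hlow k]
  · obtain ⟨y, hy⟩ := exists_lt_of_ciInf_lt hb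
    have hlim : Tendsto (fun k : ℕ => δ y (T y) + (δ x y + δ y x) / (k : ℝ)) atTop
        (𝓝 (δ y (T y))) := by
      simpa using (tendsto_const_div_atTop_nhds_zero_nat (δ x y + δ y x)).const_add (δ y (T y))
    filter_upwards [eventually_gt_atTop 0, hlim.eventually_lt_const hy] with k hk hkb
    have hk' : (0 : ℝ) < k := Nat.cast_pos.2 hk
    refine lt_of_le_of_lt ?_ hkb
    rw [div_le_iff₀ hk', add_mul, div_mul_cancel₀ _ hk'.ne']
    linarith [hemimetric_self_iterate_le_add htri hself hT x y k]
end

section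
/- Let Ω be a compact topological space, X = C(Ω,ℝ) with the sup-norm, and let T : X → X be order-preserving and commute with the addition of a constant. Set ρ̄₊(T) = inf_{y∈X} max_{ω∈Ω} (T(y)(ω) − y(ω)). Then for every x ∈ X there exists ω₊ ∈ Ω such that T^k(x)(ω₊) ≥ x(ω₊) + k·ρ̄₊(T) for all k ∈ ℕ. -/
open Filter Topology

/-- A self-map that is monotone and commutes with constants satisfies `T y - y ≥ -‖T 0‖`
somewhere, so the infimum over `y` of the maximum of `T y - y` is over a set bounded below. -/
lemma bddBelow_range_iSup_sub {Ω : Type*} [TopologicalSpace Ω] [CompactSpace Ω] [Nonempty Ω]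
    {T : C(Ω, ℝ) → C(Ω, ℝ)}
    (hmono : ∀ x y : C(Ω, ℝ), x ≤ y → T x ≤ T y)
    (hconst : ∀ (c : ℝ) (x : C(Ω, ℝ)),
      T (ContinuousMap.const Ω c + x) = ContinuousMap.const Ω c + T x) :
    BddBelow (Set.range fun y : C(Ω, ℝ) => ⨆ ω : Ω, (T y ω - y ω)) := by
  refine ⟨-‖T 0‖, ?_⟩
  rintro _ ⟨y, rfl⟩
  obtain ⟨ω, -, hω⟩ := isCompact_univ.exists_isMinOn Set.univ_nonempty y.continuous.continuousOn
  have hle : ContinuousMap.const Ω (y ω) + 0 ≤ y := fun ω' => by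
    simpa using hω (Set.mem_univ ω')
  have hT : ContinuousMap.const Ω (y ω) ω + T 0 ω ≤ T y ω := by
    rw [← ContinuousMap.add_apply, ← hconst]
    exact hmono _ _ hle ω
  have hnorm := (abs_le.mp ((T 0).norm_coe_le_norm ω)).1
  have hbdd : BddAbove (Set.range fun ω => T y ω - y ω) :=
    (isCompact_range (by fun_prop)).bddAbove
  refine le_trans ?_ (le_ciSup hbdd ω)
  rw [ContinuousMap.const_apply] at hT
  linarith

/-- If every point has a positive return time `k ≤ m` at which the orbit of `x` has grown at rate
less than `r`, then some `y` satisfies `T y ≤ r + y`. -/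
lemma exists_map_le_const_add {Ω : Type*} [TopologicalSpace Ω]
    {T : C(Ω, ℝ) → C(Ω, ℝ)}
    (hmono : ∀ x y : C(Ω, ℝ), x ≤ y → T x ≤ T y)
    (hconst : ∀ (c : ℝ) (x : C(Ω, ℝ)),
      T (ContinuousMap.const Ω c + x) = ContinuousMap.const Ω c + T x)
    (x : C(Ω, ℝ)) (r : ℝ) (m : ℕ)
    (h : ∀ ω, ∃ k ≤ m, T^[k] x ω < x ω + k * r) :
    ∃ y : C(Ω, ℝ), ∀ ω, T y ω ≤ y ω + r := by
  let u : ℕ → C(Ω, ℝ) := fun k => ContinuousMap.const Ω (-(k * r)) + T^[k] x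
  have hne : (Finset.range (m + 1)).Nonempty := ⟨0, by simp⟩
  let y : C(Ω, ℝ) := (Finset.range (m + 1)).inf' hne u
  have hy : ∀ k ≤ m, ∀ ω, T y ω ≤ u (k + 1) ω + r := by
    intro k hk ω
    have hT : T y ω ≤ T (u k) ω :=
      hmono _ _ (Finset.inf'_le u (Finset.mem_range.mpr (Nat.lt_succ_of_le hk))) ω
    simp only [u, hconst, ← Function.iterate_succ_apply' T k x, ContinuousMap.add_apply,
      ContinuousMap.const_apply] at hT ⊢
    push_cast
    linarith
  refine ⟨y, fun ω => ?_⟩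
  have hyω : y ω = (Finset.range (m + 1)).inf' hne fun k => u k ω :=
    ContinuousMap.inf'_apply hne u ω
  rw [← sub_le_iff_le_add, hyω, Finset.le_inf'_iff]
  intro k hk
  rw [sub_le_iff_le_add]
  rcases k with _ | k
  · obtain ⟨j, hj, hlt⟩ := h ω
    rcases j with _ | j
    · simp at hlt
    · have := hy j (by omega) ω
      simp only [u, ContinuousMap.add_apply, ContinuousMap.const_apply] at this ⊢
      simp only [Function.iterate_zero, id, Nat.cast_zero, zero_mul, neg_zero, zero_add]
      linarith
  · exact hy k (by have := Finset.mem_range.mp hk; omega) ω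

/-- Let `Ω` be a compact topological space, `X = C(Ω, ℝ)` with the
sup-norm, and `T : X → X` order-preserving and commuting with the addition of a
constant.  Then for every `x ∈ X` there exists `ωplus ∈ Ω` such that
`T^k(x)(ωplus) ≥ x(ωplus) + k · ρ̄₊(T)` for all `k ∈ ℕ`, where
`ρ̄₊(T) = inf_y max_ω (T(y)(ω) − y(ω))`. -/
theorem shapley_operator_good_state {Ω : Type*} [TopologicalSpace Ω] [CompactSpace Ω]
    [Nonempty Ω]
    (T : C(Ω, ℝ) → C(Ω, ℝ))
    (hmono : ∀ x y : C(Ω, ℝ), x ≤ y → T x ≤ T y)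
    (hconst : ∀ (c : ℝ) (x : C(Ω, ℝ)),
      T (ContinuousMap.const Ω c + x) = ContinuousMap.const Ω c + T x)
    (x : C(Ω, ℝ)) :
    ∃ ωplus : Ω, ∀ k : ℕ,
      T^[k] x ωplus ≥ x ωplus + (k : ℝ) * ⨅ y : C(Ω, ℝ), ⨆ ω : Ω, (T y ω - y ω) := by
  set ρ : ℝ := ⨅ y : C(Ω, ℝ), ⨆ ω : Ω, (T y ω - y ω) with hρ
  let F : ℕ → Set Ω := fun m => {ω | ∀ k ≤ m, x ω + k * (ρ - 1 / ((m : ℝ) + 1)) ≤ T^[k] x ω}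
  have hF_closed : ∀ m, IsClosed (F m) := fun m => by
    simp only [F, Set.ofPred_forall]
    exact isClosed_iInter fun k => isClosed_iInter fun _ =>
      isClosed_le (by fun_prop) (T^[k] x).continuous
  have hF_anti : ∀ m, F (m + 1) ⊆ F m := fun m ω hω k hk => by
    refine le_trans ?_ (hω k (by omega))
    have : 1 / (((m + 1 : ℕ) : ℝ) + 1) ≤ 1 / ((m : ℝ) + 1) := by
      gcongr
      simp
    gcongr
  have hF_nonempty : ∀ m, (F m).Nonempty := fun m => by
    by_contra hempty
    have h : ∀ ω, ∃ k ≤ m, T^[k] x ω < x ω + k * (ρ - 1 / ((m : ℝ) + 1)) := fun ω => by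
      by_contra! hω
      exact hempty ⟨ω, hω⟩
    obtain ⟨y, hy⟩ := exists_map_le_const_add hmono hconst x _ m h
    have hle : ρ ≤ ⨆ ω : Ω, (T y ω - y ω) := ciInf_le (bddBelow_range_iSup_sub hmono hconst) y
    have hsup : ⨆ ω : Ω, (T y ω - y ω) ≤ ρ - 1 / ((m : ℝ) + 1) :=
      ciSup_le fun ω => sub_le_iff_le_add'.mpr (hy ω)
    have : 0 < 1 / ((m : ℝ) + 1) := by positivity
    linarith
  obtain ⟨ω, hω⟩ := IsCompact.nonempty_iInter_of_sequence_nonempty_isCompact_isClosed F hF_anti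
    hF_nonempty (hF_closed 0).isCompact hF_closed
  refine ⟨ω, fun k => ?_⟩
  have hlim : Tendsto (fun m : ℕ => x ω + k * (ρ - 1 / ((m : ℝ) + 1))) atTop
      (𝓝 (x ω + k * (ρ - 0))) :=
    ((tendsto_one_div_add_atTop_nhds_zero_nat.const_sub ρ).const_mul _).const_add _
  rw [sub_zero] at hlim
  exact le_of_tendsto hlim <|
    (eventually_ge_atTop k).mono fun m hm => Set.mem_iInter.mp hω m k hm
end

section
/- Let C be a closed, convex and pointed cone with nonempty interior in ℝⁿ, with dual cone C* = {φ : φ(w) ≥ 0 for all w ∈ C}. Let x, y, z ∈ C \ {0} be such that μx ≥ y and z ≥ νx for some μ, ν > 0. Then M(y/x) = sup{φ(y)/φ(x) : φ ∈ C*, φ(x) ≠ 0} and m(z/x) = inf{φ(z)/φ(x) : φ ∈ C*, φ(x) ≠ 0}. Moreover, if x ∈ int C then the supremum is attained and the condition φ(x) ≠ 0 can be replaced by φ ∈ C* \ {0} (indeed φ(x) > 0 for every φ ∈ C* \ {0}); if z ∈ int C then the infimum is attained. -/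
open Set

section ConeDuality

variable {E : Type*} [NormedAddCommGroup E] [NormedSpace ℝ E] {C : Set E}

theorem exists_pos_sub_smul_mem_of_mem_interior {p : E} (hp : p ∈ interior C) (v : E) :
    ∃ δ : ℝ, 0 < δ ∧ p - δ • v ∈ C := by
  have hcont : Filter.Tendsto (fun t : ℝ ↦ p - t • v) (nhdsWithin 0 (Ioi 0)) (nhds p) := by
    have : Continuous (fun t : ℝ ↦ p - t • v) := by fun_prop
    simpa using (this.tendsto 0).mono_left nhdsWithin_le_nhds
  obtain ⟨δ, hδ, hpos⟩ :=
    ((hcont.eventually (mem_interior_iff_mem_nhds.1 hp)).and self_mem_nhdsWithin).exists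
  exact ⟨δ, hpos, hδ⟩

theorem add_mem_of_convex_of_smul_mem (hconv : Convex ℝ C)
    (hcone : ∀ x ∈ C, ∀ t : ℝ, 0 ≤ t → t • x ∈ C) {a b : E} (ha : a ∈ C) (hb : b ∈ C) :
    a + b ∈ C := by
  have h := hcone _ (hconv ha hb (by norm_num : (0 : ℝ) ≤ 1 / 2)
    (by norm_num : (0 : ℝ) ≤ 1 / 2) (by norm_num)) 2 (by norm_num)
  convert h using 1
  module

theorem nonneg_of_lower_bound_on_cone (hcone : ∀ x ∈ C, ∀ t : ℝ, 0 ≤ t → t • x ∈ C)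
    {φ : E →ₗ[ℝ] ℝ} {u : ℝ} (hu : ∀ w ∈ C, u ≤ φ w) {w : E} (hw : w ∈ C) : 0 ≤ φ w := by
  by_contra! h
  have h0 : u ≤ 0 := by simpa using hu _ (hcone w hw 0 le_rfl)
  have h1 := hu _ (hcone w hw ((u - 1) / φ w) (div_nonneg_of_nonpos (by linarith) h.le))
  rw [map_smul, smul_eq_mul, div_mul_cancel₀ _ h.ne] at h1
  linarith

theorem mem_cone_iff_forall_dual_nonneg (hclosed : IsClosed C) (hconv : Convex ℝ C)
    (hcone : ∀ x ∈ C, ∀ t : ℝ, 0 ≤ t → t • x ∈ C) (hne : C.Nonempty) {p : E} :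
    p ∈ C ↔ ∀ φ : E →ₗ[ℝ] ℝ, (∀ w ∈ C, 0 ≤ φ w) → 0 ≤ φ p := by
  refine ⟨fun hp φ hφ ↦ hφ p hp, fun h ↦ ?_⟩
  by_contra hp
  obtain ⟨f, u, hfp, hfC⟩ := geometric_hahn_banach_point_closed hconv hclosed hp
  obtain ⟨c, hc⟩ := hne
  have h0 : u < 0 := by simpa using hfC _ (hcone c hc 0 le_rfl)
  have hf := h f.toLinearMap fun w hw ↦
    nonneg_of_lower_bound_on_cone hcone (fun w hw ↦ (hfC w hw).le) hw
  have hf' : 0 ≤ f p := hf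
  linarith

theorem exists_dual_eq_zero_of_notMem_interior (hconv : Convex ℝ C)
    (hcone : ∀ x ∈ C, ∀ t : ℝ, 0 ≤ t → t • x ∈ C) (hint : (interior C).Nonempty)
    {p : E} (hp : p ∈ C) (hp' : p ∉ interior C) :
    ∃ φ : E →ₗ[ℝ] ℝ, (∀ w ∈ C, 0 ≤ φ w) ∧ φ ≠ 0 ∧ φ p = 0 := by
  obtain ⟨f, hf0, hf⟩ := geometric_hahn_banach_of_nonempty_interior_point hconv hp' hint
  have hlow : ∀ w ∈ C, -f p ≤ (-f).toLinearMap w := fun w hw ↦ by simpa using hf w hw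
  have hnonneg : ∀ w ∈ C, 0 ≤ (-f).toLinearMap w :=
    fun w hw ↦ nonneg_of_lower_bound_on_cone hcone hlow hw
  refine ⟨(-f).toLinearMap, hnonneg, fun h ↦ hf0 ?_, le_antisymm ?_ (hnonneg p hp)⟩
  · ext v
    simpa using LinearMap.congr_fun h v
  · simpa using hf _ (hcone p hp 0 le_rfl)

theorem dual_pos_of_mem_interior {p : E} (hp : p ∈ interior C) {φ : E →ₗ[ℝ] ℝ}
    (hφ : ∀ w ∈ C, 0 ≤ φ w) (hφ0 : φ ≠ 0) : 0 < φ p := by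
  obtain ⟨v, hv⟩ : ∃ v, 0 < φ v := by
    by_contra! h
    refine hφ0 (LinearMap.ext fun v ↦ le_antisymm (h v) ?_)
    simpa using h (-v)
  obtain ⟨δ, hδ, hmem⟩ := exists_pos_sub_smul_mem_of_mem_interior hp v
  have h := hφ _ hmem
  rw [map_sub, map_smul, smul_eq_mul] at h
  linarith [mul_pos hδ hv]

end ConeDuality


/-- Let `C` be a closed, convex, pointed cone with nonempty interior
in `ℝⁿ`, with dual cone `C* = {φ | φ(w) ≥ 0 ∀ w ∈ C}`.  For `x, y, z ∈ C \ {0}`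
with `μ•x ≥ y` and `z ≥ ν•x` for some `μ, ν > 0`:
`M(y/x) = sup {φ(y)/φ(x) | φ ∈ C*, φ(x) ≠ 0}` and
`m(z/x) = inf {φ(z)/φ(x) | φ ∈ C*, φ(x) ≠ 0}`.
If `x ∈ int C` then `φ(x) > 0` for all `φ ∈ C* \ {0}`, the condition `φ(x) ≠ 0`
can be replaced by `φ ≠ 0`, and the supremum is attained; if `z ∈ int C` the
infimum is attained. -/
theorem funk_dual_formulas {n : ℕ} (C : Set (EuclideanSpace ℝ (Fin n)))
    (hclosed : IsClosed C) (hconv : Convex ℝ C)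
    (hcone : ∀ x ∈ C, ∀ t : ℝ, 0 ≤ t → t • x ∈ C)
    (hpointed : ∀ x ∈ C, -x ∈ C → x = 0)
    (hint : (interior C).Nonempty)
    (x y z : EuclideanSpace ℝ (Fin n))
    (hx : x ∈ C) (hx0 : x ≠ 0) (hy : y ∈ C) (hy0 : y ≠ 0) (hz : z ∈ C) (hz0 : z ≠ 0)
    (μ ν : ℝ) (hμ : 0 < μ) (hν : 0 < ν)
    (hμx : μ • x - y ∈ C) (hνx : z - ν • x ∈ C) :
    sInf {l : ℝ | 0 < l ∧ l • x - y ∈ C}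
      = sSup {r : ℝ | ∃ φ : EuclideanSpace ℝ (Fin n) →ₗ[ℝ] ℝ,
          (∀ w ∈ C, 0 ≤ φ w) ∧ φ x ≠ 0 ∧ r = φ y / φ x} ∧
    sSup {l : ℝ | 0 < l ∧ z - l • x ∈ C}
      = sInf {r : ℝ | ∃ φ : EuclideanSpace ℝ (Fin n) →ₗ[ℝ] ℝ,
          (∀ w ∈ C, 0 ≤ φ w) ∧ φ x ≠ 0 ∧ r = φ z / φ x} ∧
    (x ∈ interior C →
      (∀ φ : EuclideanSpace ℝ (Fin n) →ₗ[ℝ] ℝ,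
          (∀ w ∈ C, 0 ≤ φ w) → φ ≠ 0 → 0 < φ x) ∧
      sInf {l : ℝ | 0 < l ∧ l • x - y ∈ C}
        = sSup {r : ℝ | ∃ φ : EuclideanSpace ℝ (Fin n) →ₗ[ℝ] ℝ,
            (∀ w ∈ C, 0 ≤ φ w) ∧ φ ≠ 0 ∧ r = φ y / φ x} ∧
      (∃ φ : EuclideanSpace ℝ (Fin n) →ₗ[ℝ] ℝ, (∀ w ∈ C, 0 ≤ φ w) ∧ φ ≠ 0 ∧
        φ y / φ x = sInf {l : ℝ | 0 < l ∧ l • x - y ∈ C})) ∧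
    (z ∈ interior C →
      ∃ φ : EuclideanSpace ℝ (Fin n) →ₗ[ℝ] ℝ, (∀ w ∈ C, 0 ≤ φ w) ∧ φ x ≠ 0 ∧
        φ z / φ x = sSup {l : ℝ | 0 < l ∧ z - l • x ∈ C}) := by
  have hmem {p : EuclideanSpace ℝ (Fin n)} :=
    mem_cone_iff_forall_dual_nonneg (p := p) hclosed hconv hcone ⟨x, hx⟩
  have hadd {a b : EuclideanSpace ℝ (Fin n)} (ha : a ∈ C) (hb : b ∈ C) : a + b ∈ C :=
    add_mem_of_convex_of_smul_mem hconv hcone ha hb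
  obtain ⟨φ₀, hφ₀, hφ₀x⟩ : ∃ φ : EuclideanSpace ℝ (Fin n) →ₗ[ℝ] ℝ,
      (∀ w ∈ C, 0 ≤ φ w) ∧ φ x ≠ 0 := by
    by_contra! h
    refine hx0 (hpointed x hx (hmem.2 fun φ hφ ↦ ?_))
    simp [h φ hφ]
  set S := {l : ℝ | 0 < l ∧ l • x - y ∈ C} with hS
  set T := {l : ℝ | 0 < l ∧ z - l • x ∈ C} with hT
  set R := {r : ℝ | ∃ φ : EuclideanSpace ℝ (Fin n) →ₗ[ℝ] ℝ,
    (∀ w ∈ C, 0 ≤ φ w) ∧ φ x ≠ 0 ∧ r = φ y / φ x} with hR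
  set Q := {r : ℝ | ∃ φ : EuclideanSpace ℝ (Fin n) →ₗ[ℝ] ℝ,
    (∀ w ∈ C, 0 ≤ φ w) ∧ φ x ≠ 0 ∧ r = φ z / φ x} with hQ
  have hRne : R.Nonempty := ⟨_, φ₀, hφ₀, hφ₀x, rfl⟩
  have hQne : Q.Nonempty := ⟨_, φ₀, hφ₀, hφ₀x, rfl⟩
  have hSpos {l : ℝ} (hl : l • x - y ∈ C) : 0 < l := by
    by_contra! h
    refine hy0 (hpointed y hy ?_)
    convert hadd hl (hcone x hx (-l) (by linarith)) using 1
    module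
  have hSub : S = upperBounds R := by
    ext l
    constructor
    · rintro ⟨-, hl⟩ _ ⟨φ, hφ, hφx, rfl⟩
      have h := hφ _ hl
      rw [map_sub, map_smul, smul_eq_mul] at h
      rw [div_le_iff₀ (lt_of_le_of_ne (hφ x hx) hφx.symm)]
      linarith
    · intro hl
      suffices h : l • x - y ∈ C from ⟨hSpos h, h⟩
      refine hmem.2 fun φ hφ ↦ ?_
      rw [map_sub, map_smul, smul_eq_mul]
      by_cases hφx : φ x = 0
      · have h := hφ _ hμx
        rw [map_sub, map_smul, smul_eq_mul, hφx] at h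
        rw [hφx]
        linarith
      · have h := hl ⟨φ, hφ, hφx, rfl⟩
        rw [div_le_iff₀ (lt_of_le_of_ne (hφ x hx) (Ne.symm hφx))] at h
        linarith
  have hQlb {l : ℝ} : z - l • x ∈ C ↔ l ∈ lowerBounds Q := by
    constructor
    · rintro hl _ ⟨φ, hφ, hφx, rfl⟩
      have h := hφ _ hl
      rw [map_sub, map_smul, smul_eq_mul] at h
      rw [le_div_iff₀ (lt_of_le_of_ne (hφ x hx) hφx.symm)]
      linarith
    · intro hl
      refine hmem.2 fun φ hφ ↦ ?_
      rw [map_sub, map_smul, smul_eq_mul]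
      by_cases hφx : φ x = 0
      · simpa [hφx] using hφ z hz
      · have h := hl ⟨φ, hφ, hφx, rfl⟩
        rw [le_div_iff₀ (lt_of_le_of_ne (hφ x hx) (Ne.symm hφx))] at h
        linarith
  have hRlub : IsLUB R (sSup R) :=
    isLUB_csSup hRne ⟨μ, hSub ▸ (⟨hμ, hμx⟩ : μ ∈ S)⟩
  have hSleast : IsLeast S (sSup R) := hSub ▸ hRlub
  have hQglb : IsGLB Q (sInf Q) := isGLB_csInf hQne ⟨ν, hQlb.1 hνx⟩
  have hTgreatest : IsGreatest T (sInf Q) :=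
    ⟨⟨hν.trans_le (hQglb.2 (hQlb.1 hνx)), hQlb.2 hQglb.1⟩, fun l hl ↦ hQglb.2 (hQlb.1 hl.2)⟩
  refine ⟨hSleast.csInf_eq, hTgreatest.csSup_eq, fun hxint ↦ ⟨fun φ hφ hφ0 ↦
    dual_pos_of_mem_interior hxint hφ hφ0, ?_, ?_⟩, fun hzint ↦ ?_⟩
  · rw [hSleast.csInf_eq]
    congr 1
    ext r
    refine exists_congr fun φ ↦ and_congr_right fun hφ ↦ and_congr_left fun _ ↦ ⟨?_, ?_⟩
    · rintro hφx rfl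
      exact hφx rfl
    · exact fun hφ0 ↦ (dual_pos_of_mem_interior hxint hφ hφ0).ne'
  · rw [hSleast.csInf_eq]
    have hnot : sSup R • x - y ∉ interior C := fun h ↦ by
      obtain ⟨δ, hδ, hδC⟩ := exists_pos_sub_smul_mem_of_mem_interior h x
      have h' : (sSup R - δ) • x - y ∈ C := by
        convert hδC using 1
        module
      linarith [hSleast.2 ⟨hSpos h', h'⟩]
    obtain ⟨φ, hφ, hφ0, hφp⟩ :=
      exists_dual_eq_zero_of_notMem_interior hconv hcone hint hSleast.1.2 hnot
    refine ⟨φ, hφ, hφ0, ?_⟩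
    rw [map_sub, map_smul, smul_eq_mul] at hφp
    rw [div_eq_iff (dual_pos_of_mem_interior hxint hφ hφ0).ne']
    linarith
  · rw [hTgreatest.csSup_eq]
    have hnot : z - sInf Q • x ∉ interior C := fun h ↦ by
      obtain ⟨δ, hδ, hδC⟩ := exists_pos_sub_smul_mem_of_mem_interior h x
      have h' : z - (sInf Q + δ) • x ∈ C := by
        convert hδC using 1
        module
      linarith [hQglb.2 (hQlb.1 h')]
    obtain ⟨φ, hφ, hφ0, hφp⟩ :=
      exists_dual_eq_zero_of_notMem_interior hconv hcone hint hTgreatest.1.2 hnot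
    rw [map_sub, map_smul, smul_eq_mul] at hφp
    have hφz := dual_pos_of_mem_interior hzint hφ hφ0
    have hφx : φ x ≠ 0 := fun h ↦ by
      rw [h] at hφp
      linarith
    refine ⟨φ, hφ, hφx, ?_⟩
    rw [div_eq_iff hφx]
    linarith
end

section
/- Let C be a closed, convex and pointed cone with nonempty interior in ℝⁿ and let T be a self-map of int C. Then: (i) T is order-preserving (x ≤ y implies T(x) ≤ T(y)) and positively homogeneous (T(λx) = λT(x) for all λ > 0 and x ∈ int C) if and only if RFunk(T(x),T(y)) ≤ RFunk(x,y) for all x,y ∈ int C; (ii) T is order-preserving and sub-homogeneous (T(λx) ≤ λT(x) for all λ ≥ 1 and x ∈ int C) if and only if RFunk⁺(T(x),T(y)) ≤ RFunk⁺(x,y) for all x,y ∈ int C. -/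
/-- `M(y/x) = inf {λ > 0 | λ • x − y ∈ C}`. -/
noncomputable def MFunk {n : ℕ} (C : Set (EuclideanSpace ℝ (Fin n)))
    (x y : EuclideanSpace ℝ (Fin n)) : ℝ :=
  sInf {l : ℝ | 0 < l ∧ l • x - y ∈ C}

/-- The reverse Funk hemi-metric `RFunk(x,y) = log M(y/x)`. -/
noncomputable def RFunk {n : ℕ} (C : Set (EuclideanSpace ℝ (Fin n)))
    (x y : EuclideanSpace ℝ (Fin n)) : ℝ :=
  Real.log (MFunk C x y)

/-- `RFunk⁺(x,y) = max (RFunk(x,y)) 0`. -/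
noncomputable def RFunkPlus {n : ℕ} (C : Set (EuclideanSpace ℝ (Fin n)))
    (x y : EuclideanSpace ℝ (Fin n)) : ℝ :=
  max (RFunk C x y) 0

section ConeLemmas

variable {E : Type*} [NormedAddCommGroup E] [NormedSpace ℝ E] {C : Set E}

theorem add_mem_of_convex_of_cone (hconv : Convex ℝ C)
    (hcone : ∀ x ∈ C, ∀ t : ℝ, 0 ≤ t → t • x ∈ C) {x y : E} (hx : x ∈ C) (hy : y ∈ C) :
    x + y ∈ C := by
  have h := hconv (hcone x hx 2 zero_le_two) (hcone y hy 2 zero_le_two)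
    (a := 1 / 2) (b := 1 / 2) (by norm_num) (by norm_num) (by norm_num)
  simpa [smul_smul] using h

open scoped Pointwise in
theorem smul_mem_interior_of_cone (hcone : ∀ x ∈ C, ∀ t : ℝ, 0 ≤ t → t • x ∈ C) {x : E}
    (hx : x ∈ interior C) {t : ℝ} (ht : 0 < t) : t • x ∈ interior C := by
  have hsub : t • C ⊆ C := by
    rintro _ ⟨z, hz, rfl⟩
    exact hcone z hz t ht.le
  refine interior_mono hsub ?_
  rw [interior_smul₀ ht.ne']
  exact Set.smul_mem_smul_set hx

theorem exists_pos_sub_smul_mem {x : E} (hx : x ∈ interior C) (y : E) :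
    ∃ ε : ℝ, 0 < ε ∧ x - ε • y ∈ C := by
  have hcont : Continuous fun ε : ℝ => x - ε • y := by fun_prop
  have hmem : ∀ᶠ ε : ℝ in nhds 0, x - ε • y ∈ C := by
    refine hcont.continuousAt ?_
    simpa using mem_interior_iff_mem_nhds.mp hx
  obtain ⟨ε, hε, hpos⟩ :=
    ((hmem.filter_mono nhdsWithin_le_nhds).and
      (self_mem_nhdsWithin : Set.Ioi (0 : ℝ) ∈ nhdsWithin 0 (Set.Ioi 0))).exists
  exact ⟨ε, hpos, hε⟩

theorem subsingleton_of_zero_mem_interior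
    (hcone : ∀ x ∈ C, ∀ t : ℝ, 0 ≤ t → t • x ∈ C)
    (hpointed : ∀ x ∈ C, -x ∈ C → x = 0) (h0 : (0 : E) ∈ interior C) : Subsingleton E := by
  have hneg : ∀ v : E, -v ∈ C := fun v => by
    obtain ⟨ε, hε, hv⟩ := exists_pos_sub_smul_mem h0 v
    simpa [smul_smul, hε.ne'] using hcone _ hv ε⁻¹ (inv_pos.mpr hε).le
  refine subsingleton_of_forall_eq 0 fun v => hpointed v ?_ (hneg v)
  simpa using hneg (-v)

end ConeLemmas

section Funk

variable {n : ℕ} {C : Set (EuclideanSpace ℝ (Fin n))}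

theorem rfunk_le_iff (hclosed : IsClosed C) (hconv : Convex ℝ C)
    (hcone : ∀ x ∈ C, ∀ t : ℝ, 0 ≤ t → t • x ∈ C)
    (hpointed : ∀ x ∈ C, -x ∈ C → x = 0) (h0 : 0 ∉ interior C)
    {x y : EuclideanSpace ℝ (Fin n)} (hx : x ∈ interior C) (hy : y ∈ interior C) (r : ℝ) :
    RFunk C x y ≤ r ↔ Real.exp r • x - y ∈ C := by
  set S : Set ℝ := {l : ℝ | 0 < l ∧ l • x - y ∈ C}
  have hbdd : BddBelow S := ⟨0, fun l hl => hl.1.le⟩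
  have hne : S.Nonempty := by
    obtain ⟨ε, hε, hxy⟩ := exists_pos_sub_smul_mem hx y
    refine ⟨ε⁻¹, inv_pos.mpr hε, ?_⟩
    simpa [smul_sub, smul_smul, hε.ne'] using hcone _ hxy ε⁻¹ (inv_pos.mpr hε).le
  have hmem : MFunk C x y • x - y ∈ C := by
    have hcl : IsClosed {l : ℝ | l • x - y ∈ C} :=
      hclosed.preimage (by fun_prop : Continuous fun l : ℝ => l • x - y)
    exact closure_minimal (fun l hl => hl.2) hcl (csInf_mem_closure hne hbdd)
  have hnonneg : 0 ≤ MFunk C x y := Real.sInf_nonneg fun l hl => hl.1.le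
  have hpos : 0 < MFunk C x y := by
    refine hnonneg.lt_of_ne fun h => h0 ?_
    rw [← h, zero_smul, zero_sub] at hmem
    rwa [← hpointed y (interior_subset hy) hmem]
  rw [RFunk, Real.log_le_iff_le_exp hpos]
  refine ⟨fun h => ?_, fun h => csInf_le hbdd ⟨Real.exp_pos r, h⟩⟩
  have hadd := add_mem_of_convex_of_cone hconv hcone hmem
    (hcone x (interior_subset hx) _ (sub_nonneg.mpr h))
  convert hadd using 1
  module

theorem rfunkPlus_le_iff (hclosed : IsClosed C) (hconv : Convex ℝ C)
    (hcone : ∀ x ∈ C, ∀ t : ℝ, 0 ≤ t → t • x ∈ C)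
    (hpointed : ∀ x ∈ C, -x ∈ C → x = 0) (h0 : 0 ∉ interior C)
    {x y : EuclideanSpace ℝ (Fin n)} (hx : x ∈ interior C) (hy : y ∈ interior C)
    {r : ℝ} (hr : 0 ≤ r) :
    RFunkPlus C x y ≤ r ↔ Real.exp r • x - y ∈ C := by
  rw [RFunkPlus, max_le_iff, and_iff_left hr,
    rfunk_le_iff hclosed hconv hcone hpointed h0 hx hy]

end Funk

/-- Let `C` be a closed, convex, pointed cone with nonempty interior
in `ℝⁿ` and `T` a self-map of `int C`. Then (i) `T` is order-preserving and
positively homogeneous iff it is non-expansive for `RFunk`; (ii) `T` is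
order-preserving and sub-homogeneous iff it is non-expansive for `RFunk⁺`. -/
theorem rfunk_nonexpansive_characterisation {n : ℕ}
    (C : Set (EuclideanSpace ℝ (Fin n)))
    (hclosed : IsClosed C) (hconv : Convex ℝ C)
    (hcone : ∀ x ∈ C, ∀ t : ℝ, 0 ≤ t → t • x ∈ C)
    (hpointed : ∀ x ∈ C, -x ∈ C → x = 0)
    (hint : (interior C).Nonempty)
    (T : EuclideanSpace ℝ (Fin n) → EuclideanSpace ℝ (Fin n))
    (hT : Set.MapsTo T (interior C) (interior C)) :
    (((∀ x ∈ interior C, ∀ y ∈ interior C, y - x ∈ C → T y - T x ∈ C) ∧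
       (∀ l : ℝ, 0 < l → ∀ x ∈ interior C, T (l • x) = l • T x)) ↔
      (∀ x ∈ interior C, ∀ y ∈ interior C, RFunk C (T x) (T y) ≤ RFunk C x y)) ∧
    (((∀ x ∈ interior C, ∀ y ∈ interior C, y - x ∈ C → T y - T x ∈ C) ∧
       (∀ l : ℝ, 1 ≤ l → ∀ x ∈ interior C, l • T x - T (l • x) ∈ C)) ↔
      (∀ x ∈ interior C, ∀ y ∈ interior C,
        RFunkPlus C (T x) (T y) ≤ RFunkPlus C x y)) := by
  by_cases h0 : (0 : EuclideanSpace ℝ (Fin n)) ∈ interior C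
  · have := subsingleton_of_zero_mem_interior hcone hpointed h0
    have hC : ∀ v : EuclideanSpace ℝ (Fin n), v ∈ C := fun v =>
      Subsingleton.elim 0 v ▸ interior_subset h0
    have hTid : ∀ x, T x = x := fun x => Subsingleton.elim _ _
    refine ⟨iff_of_true ⟨fun _ _ _ _ _ => hC _, fun _ _ _ _ => Subsingleton.elim _ _⟩ ?_,
      iff_of_true ⟨fun _ _ _ _ _ => hC _, fun _ _ _ _ => hC _⟩ ?_⟩ <;>
    · intro x _ y _
      rw [hTid, hTid]
  have hsmul : ∀ {x : EuclideanSpace ℝ (Fin n)}, x ∈ interior C → ∀ {t : ℝ}, 0 < t →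
      t • x ∈ interior C := fun hx _ ht => smul_mem_interior_of_cone hcone hx ht
  have hzero : (0 : EuclideanSpace ℝ (Fin n)) ∈ C := by
    obtain ⟨z, hz⟩ := hint
    simpa using hcone z (interior_subset hz) 0 le_rfl
  have hle : ∀ {x y : EuclideanSpace ℝ (Fin n)}, x ∈ interior C → y ∈ interior C → ∀ r : ℝ,
      RFunk C x y ≤ r ↔ Real.exp r • x - y ∈ C :=
    fun hx hy r => rfunk_le_iff hclosed hconv hcone hpointed h0 hx hy r
  have hleP : ∀ {x y : EuclideanSpace ℝ (Fin n)}, x ∈ interior C → y ∈ interior C →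
      ∀ {r : ℝ}, 0 ≤ r → (RFunkPlus C x y ≤ r ↔ Real.exp r • x - y ∈ C) :=
    fun hx hy _ hr => rfunkPlus_le_iff hclosed hconv hcone hpointed h0 hx hy hr
  refine ⟨⟨?_, ?_⟩, ⟨?_, ?_⟩⟩
  · rintro ⟨hmono, hhom⟩ x hx y hy
    have hexp := Real.exp_pos (RFunk C x y)
    rw [hle (hT hx) (hT hy), ← hhom _ hexp x hx]
    exact hmono y hy _ (hsmul hx hexp) ((hle hx hy _).mp le_rfl)
  · intro h
    have key : ∀ x ∈ interior C, ∀ y ∈ interior C, ∀ l : ℝ, 0 < l → l • x - y ∈ C →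
        l • T x - T y ∈ C := by
      intro x hx y hy l hl hxy
      rw [← Real.exp_log hl] at hxy ⊢
      rw [← hle hx hy] at hxy
      rw [← hle (hT hx) (hT hy)]
      exact (h x hx y hy).trans hxy
    refine ⟨fun x hx y hy hxy => ?_, fun l hl x hx => ?_⟩
    · simpa using key y hy x hx 1 one_pos (by simpa using hxy)
    · have hlx := hsmul hx hl
      have h₁ := key x hx _ hlx l hl (by simpa using hzero)
      have h₂ := key _ hlx x hx l⁻¹ (inv_pos.mpr hl) (by simpa [smul_smul, hl.ne'] using hzero)
      have h₃ : T (l • x) - l • T x ∈ C := by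
        simpa [smul_sub, smul_smul, hl.ne'] using hcone _ h₂ l hl.le
      exact sub_eq_zero.mp (hpointed _ h₃ (by rwa [neg_sub]))
  · rintro ⟨hmono, hsub⟩ x hx y hy
    have hnn : 0 ≤ RFunkPlus C x y := le_max_right _ _
    have hlx := hsmul hx (Real.exp_pos (RFunkPlus C x y))
    rw [hleP (hT hx) (hT hy) hnn]
    have hadd := add_mem_of_convex_of_cone hconv hcone
      (hsub _ (Real.one_le_exp hnn) x hx) (hmono y hy _ hlx ((hleP hx hy hnn).mp le_rfl))
    rwa [sub_add_sub_cancel] at hadd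
  · intro h
    have key : ∀ x ∈ interior C, ∀ y ∈ interior C, ∀ l : ℝ, 1 ≤ l → l • x - y ∈ C →
        l • T x - T y ∈ C := by
      intro x hx y hy l hl hxy
      have hlog := Real.log_nonneg hl
      rw [← Real.exp_log (one_pos.trans_le hl)] at hxy ⊢
      rw [← hleP hx hy hlog] at hxy
      rw [← hleP (hT hx) (hT hy) hlog]
      exact (h x hx y hy).trans hxy
    refine ⟨fun x hx y hy hxy => ?_, fun l hl x hx => ?_⟩
    · simpa using key y hy x hx 1 le_rfl (by simpa using hxy)
    · exact key x hx _ (hsmul hx (one_pos.trans_le hl)) l hl (by simpa using hzero)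
end

section
/- Let C be a closed, convex and pointed cone with nonempty interior in ℝⁿ, and fix a basepoint b ∈ int C. Then the Martin space of (int C, RFunk⁺) consists exactly of the functions h(x) = −RFunk(x,u) + RFunk(b,u) with u ∈ C \ {0}, together with the functions h(x) = −RFunk⁺(x,u) + RFunk⁺(b,u) with u ∈ C; and an element of the Martin space is a horofunction if and only if it is of the first form with u ∈ C \ {0}, or of the second form with u in the boundary ∂C of C. -/
/-- A closed, convex and pointed cone. -/
structure IsClosedPointedCone {n : ℕ} (C : Set (EuclideanSpace ℝ (Fin n))) : Prop where
  isClosed : IsClosed C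
  convex : Convex ℝ C
  smul_mem : ∀ x ∈ C, ∀ t : ℝ, 0 ≤ t → t • x ∈ C
  pointed : ∀ x ∈ C, -x ∈ C → x = 0

namespace IsClosedPointedCone

open Filter Topology

variable {n : ℕ} {C : Set (EuclideanSpace ℝ (Fin n))} {x y u z : EuclideanSpace ℝ (Fin n)}

theorem add_mem (hC : IsClosedPointedCone C) (hx : x ∈ C) (hy : y ∈ C) : x + y ∈ C := by
  have h := hC.smul_mem _ (hC.convex hx hy (a := 1 / 2) (b := 1 / 2) (by norm_num) (by norm_num)
    (by norm_num)) 2 (by norm_num)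
  rwa [smul_add, smul_smul, smul_smul, show (2 : ℝ) * (1 / 2) = 1 by norm_num, one_smul,
    one_smul] at h

theorem add_mem_interior (hC : IsClosedPointedCone C) (hx : x ∈ C) (hy : y ∈ interior C) :
    x + y ∈ interior C := by
  have hopen : IsOpen {w | w - x ∈ interior C} :=
    isOpen_interior.preimage (continuous_id.sub continuous_const)
  refine interior_maximal (fun w hw => ?_) hopen (by simpa using hy)
  simpa using hC.add_mem hx (interior_subset hw)

theorem smul_mem_interior (hC : IsClosedPointedCone C) (hx : x ∈ interior C) {t : ℝ}
    (ht : 0 < t) : t • x ∈ interior C := by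
  have hopen : IsOpen {w : EuclideanSpace ℝ (Fin n) | t⁻¹ • w ∈ interior C} :=
    isOpen_interior.preimage (continuous_const_smul t⁻¹)
  refine interior_maximal (fun w hw => ?_) hopen ?_
  · simpa [smul_smul, ht.ne'] using hC.smul_mem _ (interior_subset hw) t ht.le
  · simpa [smul_smul, ht.ne'] using hx

/-- An interior point of the cone dominates every vector, up to a multiple of its norm. -/
theorem exists_norm_smul_sub_mem (hC : IsClosedPointedCone C) (hx : x ∈ interior C) :
    ∃ K : ℝ, 0 < K ∧ ∀ v, (K * ‖v‖) • x - v ∈ C := by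
  obtain ⟨ε, hε, hball⟩ :=
    Metric.nhds_basis_closedBall.mem_iff.1 (mem_interior_iff_mem_nhds.1 hx)
  refine ⟨ε⁻¹, inv_pos.2 hε, fun v => ?_⟩
  rcases eq_or_ne v 0 with rfl | hv
  · simpa using hC.smul_mem x (interior_subset hx) 0 le_rfl
  have hv' : 0 < ‖v‖ := norm_pos_iff.2 hv
  have hmem : x - (ε / ‖v‖) • v ∈ C := by
    apply hball
    rw [Metric.mem_closedBall, dist_eq_norm, sub_sub_cancel_left, norm_neg, norm_smul,
      Real.norm_of_nonneg (by positivity), div_mul_cancel₀ _ hv'.ne']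
  have h := hC.smul_mem _ hmem (ε⁻¹ * ‖v‖) (by positivity)
  rwa [smul_sub, smul_smul, show ε⁻¹ * ‖v‖ * (ε / ‖v‖) = 1 by field_simp, one_smul] at h

theorem bddBelow_MFunk : BddBelow {l : ℝ | 0 < l ∧ l • x - y ∈ C} :=
  ⟨0, fun _ hl => hl.1.le⟩

theorem MFunk_nonneg : 0 ≤ MFunk C x y :=
  Real.sInf_nonneg fun _ hl => hl.1.le

theorem MFunk_le (hC : IsClosedPointedCone C) (hx : x ∈ C) {l : ℝ} (hl : 0 ≤ l)
    (h : l • x - y ∈ C) : MFunk C x y ≤ l := by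
  refine le_of_forall_pos_le_add fun ε hε => csInf_le bddBelow_MFunk ⟨by positivity, ?_⟩
  have := hC.add_mem h (hC.smul_mem x hx ε hε.le)
  rwa [show l • x - y + ε • x = (l + ε) • x - y by module] at this

theorem MFunk_smul_sub_mem (hC : IsClosedPointedCone C) (hx : x ∈ interior C)
    (y : EuclideanSpace ℝ (Fin n)) : MFunk C x y • x - y ∈ C := by
  have hne : {l : ℝ | 0 < l ∧ l • x - y ∈ C}.Nonempty := by
    obtain ⟨K, hK, h⟩ := hC.exists_norm_smul_sub_mem hx
    refine ⟨K * ‖y‖ + 1, by positivity, ?_⟩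
    have := hC.add_mem (h y) (interior_subset hx)
    rwa [show (K * ‖y‖) • x - y + x = (K * ‖y‖ + 1) • x - y by module] at this
  have hcl : IsClosed {l : ℝ | l • x - y ∈ C} :=
    hC.isClosed.preimage (by fun_prop)
  exact closure_minimal (fun l hl => hl.2) hcl (csInf_mem_closure hne bddBelow_MFunk)

theorem smul_sub_mem_of_MFunk_le (hC : IsClosedPointedCone C) (hx : x ∈ interior C) {l : ℝ}
    (h : MFunk C x y ≤ l) : l • x - y ∈ C := by
  have := hC.add_mem (hC.MFunk_smul_sub_mem hx y)
    (hC.smul_mem x (interior_subset hx) _ (sub_nonneg.2 h))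
  rwa [show MFunk C x y • x - y + (l - MFunk C x y) • x = l • x - y by module] at this

theorem MFunk_pos (hC : IsClosedPointedCone C) (hx : x ∈ interior C) (hu : u ∈ C)
    (hu0 : u ≠ 0) : 0 < MFunk C x u := by
  refine MFunk_nonneg.lt_of_ne' fun h => hu0 (hC.pointed u hu ?_)
  simpa [h] using hC.MFunk_smul_sub_mem hx u

theorem MFunk_smul_right_le (hC : IsClosedPointedCone C) (hx : x ∈ interior C) {t : ℝ}
    (ht : 0 < t) : MFunk C x (t • y) ≤ t * MFunk C x y := by
  refine hC.MFunk_le (interior_subset hx) (mul_nonneg ht.le MFunk_nonneg) ?_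
  simpa only [smul_sub, smul_smul] using hC.smul_mem _ (hC.MFunk_smul_sub_mem hx y) t ht.le

theorem MFunk_smul_right (hC : IsClosedPointedCone C) (hx : x ∈ interior C) {t : ℝ}
    (ht : 0 < t) : MFunk C x (t • y) = t * MFunk C x y := by
  refine (hC.MFunk_smul_right_le hx ht).antisymm ?_
  have h := hC.MFunk_smul_right_le (y := t • y) hx (inv_pos.2 ht)
  rw [inv_smul_smul₀ ht.ne', inv_mul_eq_div, le_div_iff₀ ht] at h
  linarith

theorem MFunk_smul_left_le (hC : IsClosedPointedCone C) (hx : x ∈ interior C) {t : ℝ}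
    (ht : 0 < t) : MFunk C (t • x) y ≤ MFunk C x y / t := by
  refine hC.MFunk_le (hC.smul_mem x (interior_subset hx) t ht.le)
    (div_nonneg MFunk_nonneg ht.le) ?_
  rw [smul_smul, div_mul_cancel₀ _ ht.ne']
  exact hC.MFunk_smul_sub_mem hx y

theorem continuous_MFunk (hC : IsClosedPointedCone C) (hx : x ∈ interior C) :
    Continuous (MFunk C x) := by
  obtain ⟨K, hK, h⟩ := hC.exists_norm_smul_sub_mem hx
  refine (LipschitzWith.of_le_add_mul K.toNNReal fun v w => ?_).continuous
  rw [Real.coe_toNNReal K hK.le, dist_eq_norm]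
  refine hC.MFunk_le (interior_subset hx)
    (add_nonneg MFunk_nonneg (mul_nonneg hK.le (norm_nonneg _))) ?_
  have := hC.add_mem (hC.MFunk_smul_sub_mem hx w) (h (v - w))
  rwa [show MFunk C x w • x - w + ((K * ‖v - w‖) • x - (v - w))
    = (MFunk C x w + K * ‖v - w‖) • x - v by module] at this

theorem RFunkPlus_eq_log_max : RFunkPlus C x y = Real.log (max (MFunk C x y) 1) := by
  rcases (MFunk_nonneg (C := C) (x := x) (y := y)).eq_or_lt with h | h
  · simp [RFunkPlus, RFunk, ← h]
  · rw [RFunkPlus, RFunk]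
    rcases le_total (MFunk C x y) 1 with h1 | h1
    · rw [max_eq_right (Real.log_nonpos h.le h1), max_eq_right h1, Real.log_one]
    · rw [max_eq_left (Real.log_nonneg h1), max_eq_left h1]

theorem RFunkPlus_nonneg : 0 ≤ RFunkPlus C x y :=
  le_max_right _ _

theorem continuous_RFunkPlus (hC : IsClosedPointedCone C) (hx : x ∈ interior C) :
    Continuous (RFunkPlus C x) := by
  have : RFunkPlus C x = fun y => Real.log (max (MFunk C x y) 1) :=
    funext fun _ => RFunkPlus_eq_log_max
  rw [this]
  exact ((hC.continuous_MFunk hx).max continuous_const).log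
    fun y => (zero_lt_one.trans_le (le_max_right _ _)).ne'

theorem RFunkPlus_eq_zero_iff (hC : IsClosedPointedCone C) (hx : x ∈ interior C) :
    RFunkPlus C x y = 0 ↔ x - y ∈ C := by
  have h1 : (1 : ℝ) ≤ max (MFunk C x y) 1 := le_max_right _ _
  constructor
  · intro h
    rw [RFunkPlus_eq_log_max] at h
    have hle : MFunk C x y ≤ 1 := by
      by_contra! hlt
      exact (Real.log_pos (hlt.trans_le (le_max_left _ _))).ne' h
    simpa using hC.smul_sub_mem_of_MFunk_le hx hle
  · intro h
    have hle : MFunk C x y ≤ 1 :=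
      hC.MFunk_le (interior_subset hx) zero_le_one (by simpa using h)
    rw [RFunkPlus_eq_log_max, max_eq_right hle, Real.log_one]

/-- `RFunk⁺(·, u)` determines `u ∈ C` up to an additive constant, when compared with an interior
point. -/
theorem eq_of_RFunkPlus_eq_add (hC : IsClosedPointedCone C) (hu : u ∈ C) (hz : z ∈ interior C)
    {c : ℝ} (h : ∀ x ∈ interior C, RFunkPlus C x u = RFunkPlus C x z + c) : u = z := by
  have hc : c = 0 := by
    have hx : u + z ∈ interior C := hC.add_mem_interior hu hz
    have h1 := (hC.RFunkPlus_eq_zero_iff (y := u) hx).2 (by simpa using interior_subset hz)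
    have h2 := (hC.RFunkPlus_eq_zero_iff (y := z) hx).2 (by simpa using hu)
    have := h _ hx
    linarith
  have hiff : ∀ x ∈ interior C, x - u ∈ C ↔ x - z ∈ C := fun x hx => by
    rw [← hC.RFunkPlus_eq_zero_iff hx, ← hC.RFunkPlus_eq_zero_iff hx, h x hx, hc, add_zero]
  have hzC := interior_subset hz
  have hzu : z - u ∈ C :=
    (hiff z hz).2 (by simpa using hC.smul_mem z hzC 0 le_rfl)
  have huz : u - z ∈ C := by
    have hlim : Tendsto (fun t : ℝ => u + t • z - z) (𝓝[>] 0) (𝓝 (u + (0 : ℝ) • z - z)) :=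
      Tendsto.mono_left (Continuous.tendsto (by fun_prop) 0) nhdsWithin_le_nhds
    rw [zero_smul, add_zero] at hlim
    refine hC.isClosed.mem_of_tendsto hlim ?_
    filter_upwards [self_mem_nhdsWithin] with t ht
    exact (hiff _ (hC.add_mem_interior hu (hC.smul_mem_interior hz ht))).1
      (by simpa using hC.smul_mem z hzC t (le_of_lt ht))
  exact sub_eq_zero.1 (hC.pointed _ huz (by simpa using hzu))

/-- The functions `RFunk(b, u) - RFunk(·, u)` are unbounded above on the interior of the cone. -/
theorem exists_lt_RFunk_sub (hC : IsClosedPointedCone C) {b : EuclideanSpace ℝ (Fin n)}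
    (hb : b ∈ interior C) (hu : u ∈ C) (hu0 : u ≠ 0) (a : ℝ) :
    ∃ x ∈ interior C, a < -RFunk C x u + RFunk C b u := by
  have ht : 0 < Real.exp (a + 1) := Real.exp_pos _
  have hx := hC.smul_mem_interior hb ht
  refine ⟨_, hx, ?_⟩
  have h := Real.log_le_log (hC.MFunk_pos hx hu hu0) (hC.MFunk_smul_left_le (y := u) hb ht)
  rw [Real.log_div (hC.MFunk_pos hb hu hu0).ne' ht.ne', Real.log_exp] at h
  rw [RFunk, RFunk]
  linarith

variable {ι : Type*} {l : Filter ι}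

theorem tendsto_RFunkPlus_sub (hC : IsClosedPointedCone C) (hx : x ∈ interior C)
    (hy : y ∈ interior C) {w : ι → EuclideanSpace ℝ (Fin n)} (hw : Tendsto w l (𝓝 u)) :
    Tendsto (fun i => RFunkPlus C x (w i) - RFunkPlus C y (w i)) l
      (𝓝 (-RFunkPlus C y u + RFunkPlus C x u)) := by
  rw [neg_add_eq_sub]
  exact (((hC.continuous_RFunkPlus hx).tendsto u).comp hw).sub
    (((hC.continuous_RFunkPlus hy).tendsto u).comp hw)

theorem tendsto_RFunk (hC : IsClosedPointedCone C) (hx : x ∈ interior C) (hu : u ∈ C)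
    (hu0 : u ≠ 0) {w : ι → EuclideanSpace ℝ (Fin n)} (hw : Tendsto w l (𝓝 u)) :
    Tendsto (fun i => RFunk C x (w i)) l (𝓝 (RFunk C x u)) :=
  (((hC.continuous_MFunk hx).tendsto u).comp hw).log (hC.MFunk_pos hx hu hu0).ne'

theorem eventually_RFunkPlus_smul (hC : IsClosedPointedCone C) (hx : x ∈ interior C)
    (hu : u ∈ C) (hu0 : u ≠ 0) {w : ι → EuclideanSpace ℝ (Fin n)} (hw : Tendsto w l (𝓝 u))
    {s : ι → ℝ} (hs : Tendsto s l atTop) :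
    ∀ᶠ i in l, RFunkPlus C x (s i • w i) = Real.log (s i) + RFunk C x (w i) := by
  have hlim : Tendsto (fun i => MFunk C x (w i)) l (𝓝 (MFunk C x u)) :=
    ((hC.continuous_MFunk hx).tendsto u).comp hw
  have htop := (Real.tendsto_log_atTop.comp hs).atTop_add (hC.tendsto_RFunk hx hu hu0 hw)
  filter_upwards [htop.eventually_ge_atTop 0, hs.eventually_gt_atTop 0,
    hlim.eventually_const_lt (hC.MFunk_pos hx hu hu0)] with i h0 hsi hMi
  have hlog : RFunk C x (s i • w i) = Real.log (s i) + RFunk C x (w i) := by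
    rw [RFunk, hC.MFunk_smul_right hx hsi, Real.log_mul hsi.ne' hMi.ne', RFunk]
  rw [RFunkPlus, hlog]
  exact max_eq_left h0

theorem tendsto_RFunkPlus_smul_sub (hC : IsClosedPointedCone C) (hx : x ∈ interior C)
    (hy : y ∈ interior C) (hu : u ∈ C) (hu0 : u ≠ 0) {w : ι → EuclideanSpace ℝ (Fin n)}
    (hw : Tendsto w l (𝓝 u)) {s : ι → ℝ} (hs : Tendsto s l atTop) :
    Tendsto (fun i => RFunkPlus C x (s i • w i) - RFunkPlus C y (s i • w i)) l
      (𝓝 (-RFunk C y u + RFunk C x u)) := by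
  rw [neg_add_eq_sub]
  refine ((hC.tendsto_RFunk hx hu hu0 hw).sub (hC.tendsto_RFunk hy hu hu0 hw)).congr' ?_
  filter_upwards [hC.eventually_RFunkPlus_smul hx hu hu0 hw hs,
    hC.eventually_RFunkPlus_smul hy hu hu0 hw hs] with i h1 h2
  rw [h1, h2]
  ring

/-- Along an ultrafilter, points of the cone either converge in the cone, or go to infinity with
directions converging in the cone. -/
theorem exists_tendsto_or_tendsto_smul (hC : IsClosedPointedCone C) (F : Ultrafilter ι)
    {z : ι → EuclideanSpace ℝ (Fin n)} (hz : ∀ i, z i ∈ C) :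
    (∃ u ∈ C, Tendsto z F (𝓝 u)) ∨
      ∃ u ∈ C, u ≠ 0 ∧ ∃ (s : ι → ℝ) (w : ι → EuclideanSpace ℝ (Fin n)),
        Tendsto s F atTop ∧ Tendsto w F (𝓝 u) ∧ ∀ i, s i • w i = z i := by
  by_cases hbdd : ∃ R : ℝ, ∀ᶠ i in F, ‖z i‖ ≤ R
  · obtain ⟨R, hR⟩ := hbdd
    have hcomp : IsCompact (C ∩ Metric.closedBall 0 R) :=
      (isCompact_closedBall _ _).inter_left hC.isClosed
    obtain ⟨u, hu, hlim⟩ := hcomp.ultrafilter_le_nhds (F.map z) (by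
      rw [le_principal_iff, Ultrafilter.coe_map, mem_map]
      filter_upwards [hR] with i hi using ⟨hz i, by simpa using hi⟩)
    exact Or.inl ⟨u, hu.1, hlim⟩
  · push Not at hbdd
    have htop : Tendsto (fun i => ‖z i‖) F atTop :=
      tendsto_atTop.2 fun R => (hbdd R).mono fun _ hi => hi.le
    have hcomp : IsCompact (C ∩ Metric.sphere 0 1) :=
      (isCompact_sphere _ _).inter_left hC.isClosed
    obtain ⟨u, hu, hlim⟩ := hcomp.ultrafilter_le_nhds (F.map fun i => ‖z i‖⁻¹ • z i) (by
      rw [le_principal_iff, Ultrafilter.coe_map, mem_map]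
      filter_upwards [htop.eventually_gt_atTop 0] with i hi
      exact ⟨hC.smul_mem _ (hz i) _ (inv_nonneg.2 hi.le), by simp [norm_smul, hi.ne']⟩)
    refine Or.inr ⟨u, hu.1, ?_, fun i => ‖z i‖, fun i => ‖z i‖⁻¹ • z i, htop, hlim, fun i => ?_⟩
    · rintro rfl
      simpa using hu.2
    · rcases eq_or_ne (z i) 0 with h | h
      · simp [h]
      · exact smul_inv_smul₀ (norm_ne_zero_iff.2 h) _

theorem tendsto_add_smul (u b : EuclideanSpace ℝ (Fin n)) :
    Tendsto (fun t : ℝ => u + t⁻¹ • b) atTop (𝓝 u) := by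
  have h : Tendsto (fun t : ℝ => t⁻¹ • b) atTop (𝓝 ((0 : ℝ) • b)) :=
    tendsto_inv_atTop_zero.smul_const b
  simpa using h.const_add u

end IsClosedPointedCone

open Filter Topology

/-- Let `C` be a closed, convex, pointed cone with nonempty interior
in `ℝⁿ` with basepoint `b ∈ int C`.  The Martin space of `(int C, RFunk⁺)`
(the closure, for pointwise convergence, of the functions
`i(z) : y ↦ RFunk⁺(b,z) − RFunk⁺(y,z)`, `z ∈ int C`) consists exactly of the
functions `x ↦ −RFunk(x,u) + RFunk(b,u)` with `u ∈ C \ {0}` together with the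
functions `x ↦ −RFunk⁺(x,u) + RFunk⁺(b,u)` with `u ∈ C`; and an element of the
Martin space is a horofunction (not of the form `i(z)`) iff it is of the first
form with `u ∈ C \ {0}` or of the second form with `u ∈ ∂C`. -/
theorem martin_space_rfunk_plus {n : ℕ} (C : Set (EuclideanSpace ℝ (Fin n)))
    (hclosed : IsClosed C) (hconv : Convex ℝ C)
    (hcone : ∀ x ∈ C, ∀ t : ℝ, 0 ≤ t → t • x ∈ C)
    (hpointed : ∀ x ∈ C, -x ∈ C → x = 0)
    (hint : (interior C).Nonempty)
    (b : EuclideanSpace ℝ (Fin n)) (hb : b ∈ interior C) :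
    closure {f : {x : EuclideanSpace ℝ (Fin n) // x ∈ interior C} → ℝ |
        ∃ z : {x : EuclideanSpace ℝ (Fin n) // x ∈ interior C},
          f = fun y : {x : EuclideanSpace ℝ (Fin n) // x ∈ interior C} =>
            RFunkPlus C b z.1 - RFunkPlus C y.1 z.1}
      = {h : {x : EuclideanSpace ℝ (Fin n) // x ∈ interior C} → ℝ |
          ∃ u : EuclideanSpace ℝ (Fin n), u ∈ C ∧ u ≠ 0 ∧
            h = fun x : {x : EuclideanSpace ℝ (Fin n) // x ∈ interior C} =>
              -(RFunk C x.1 u) + RFunk C b u} ∪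
        {h : {x : EuclideanSpace ℝ (Fin n) // x ∈ interior C} → ℝ |
          ∃ u : EuclideanSpace ℝ (Fin n), u ∈ C ∧
            h = fun x : {x : EuclideanSpace ℝ (Fin n) // x ∈ interior C} =>
              -(RFunkPlus C x.1 u) + RFunkPlus C b u} ∧
    ∀ h ∈ closure {f : {x : EuclideanSpace ℝ (Fin n) // x ∈ interior C} → ℝ |
        ∃ z : {x : EuclideanSpace ℝ (Fin n) // x ∈ interior C},
          f = fun y : {x : EuclideanSpace ℝ (Fin n) // x ∈ interior C} =>
            RFunkPlus C b z.1 - RFunkPlus C y.1 z.1},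
      ((∀ z : {x : EuclideanSpace ℝ (Fin n) // x ∈ interior C},
          h ≠ fun y : {x : EuclideanSpace ℝ (Fin n) // x ∈ interior C} =>
            RFunkPlus C b z.1 - RFunkPlus C y.1 z.1) ↔
        ((∃ u : EuclideanSpace ℝ (Fin n), u ∈ C ∧ u ≠ 0 ∧
            h = fun x : {x : EuclideanSpace ℝ (Fin n) // x ∈ interior C} =>
              -(RFunk C x.1 u) + RFunk C b u) ∨
          (∃ u : EuclideanSpace ℝ (Fin n), u ∈ frontier C ∧
            h = fun x : {x : EuclideanSpace ℝ (Fin n) // x ∈ interior C} =>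
              -(RFunkPlus C x.1 u) + RFunkPlus C b u))) := by
  have hC : IsClosedPointedCone C := ⟨hclosed, hconv, hcone, hpointed⟩
  have heq : closure {f : {x : EuclideanSpace ℝ (Fin n) // x ∈ interior C} → ℝ |
        ∃ z : {x : EuclideanSpace ℝ (Fin n) // x ∈ interior C},
          f = fun y : {x : EuclideanSpace ℝ (Fin n) // x ∈ interior C} =>
            RFunkPlus C b z.1 - RFunkPlus C y.1 z.1}
      = {h : {x : EuclideanSpace ℝ (Fin n) // x ∈ interior C} → ℝ |
          ∃ u : EuclideanSpace ℝ (Fin n), u ∈ C ∧ u ≠ 0 ∧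
            h = fun x : {x : EuclideanSpace ℝ (Fin n) // x ∈ interior C} =>
              -(RFunk C x.1 u) + RFunk C b u} ∪
        {h : {x : EuclideanSpace ℝ (Fin n) // x ∈ interior C} → ℝ |
          ∃ u : EuclideanSpace ℝ (Fin n), u ∈ C ∧
            h = fun x : {x : EuclideanSpace ℝ (Fin n) // x ∈ interior C} =>
              -(RFunkPlus C x.1 u) + RFunkPlus C b u} := by
    refine Set.Subset.antisymm (fun h hh => ?_) (fun h hh => ?_)
    · obtain ⟨G, hG, hGh⟩ := mem_closure_iff_ultrafilter.1 hh
      have hG' : ∀ᶠ f in (G : Filter ({x // x ∈ interior C} → ℝ)),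
          ∃ z : {x // x ∈ interior C}, f = fun y : {x // x ∈ interior C} =>
            RFunkPlus C b z.1 - RFunkPlus C y.1 z.1 := hG
      have hex : ∀ f : {x // x ∈ interior C} → ℝ, ∃ z ∈ interior C,
          (∃ z : {x // x ∈ interior C}, f = fun y : {x // x ∈ interior C} =>
            RFunkPlus C b z.1 - RFunkPlus C y.1 z.1) →
          ∀ y : {x // x ∈ interior C}, RFunkPlus C b z - RFunkPlus C y.1 z = f y := fun f => by
        by_cases hf : ∃ z : {x // x ∈ interior C}, f = fun y : {x // x ∈ interior C} =>
            RFunkPlus C b z.1 - RFunkPlus C y.1 z.1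
        · obtain ⟨z, rfl⟩ := hf
          exact ⟨z.1, z.2, fun _ _ => rfl⟩
        · exact ⟨b, hb, fun h => absurd h hf⟩
      choose z hz hzf using hex
      have hlim : ∀ y : {x // x ∈ interior C},
          Tendsto (fun f => RFunkPlus C b (z f) - RFunkPlus C y.1 (z f)) G (𝓝 (h y)) := fun y =>
        (((continuous_apply y).tendsto h).mono_left hGh).congr' <| by
          filter_upwards [hG'] with f hf using (hzf f hf y).symm
      rcases hC.exists_tendsto_or_tendsto_smul G (fun f => interior_subset (hz f)) with
        ⟨u, hu, hzu⟩ | ⟨u, hu, hu0, s, w, hs, hw, hsw⟩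
      · exact Or.inr ⟨u, hu, funext fun y =>
          tendsto_nhds_unique (hlim y) (hC.tendsto_RFunkPlus_sub hb y.2 hzu)⟩
      · refine Or.inl ⟨u, hu, hu0, funext fun y => tendsto_nhds_unique (hlim y) ?_⟩
        simpa only [hsw] using hC.tendsto_RFunkPlus_smul_sub hb y.2 hu hu0 hw hs
    · have hmem : ∀ u ∈ C, ∀ t : ℝ, 0 < t → u + t⁻¹ • b ∈ interior C := fun u hu t ht =>
        hC.add_mem_interior hu (hC.smul_mem_interior hb (inv_pos.2 ht))
      rcases hh with ⟨u, hu, hu0, rfl⟩ | ⟨u, hu, rfl⟩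
      · refine mem_closure_of_tendsto (tendsto_pi_nhds.2 fun y =>
          hC.tendsto_RFunkPlus_smul_sub hb y.2 hu hu0
            (IsClosedPointedCone.tendsto_add_smul u b) tendsto_id) ?_
        filter_upwards [eventually_gt_atTop 0] with t ht
        exact ⟨⟨_, hC.smul_mem_interior (hmem u hu t ht) ht⟩, rfl⟩
      · refine mem_closure_of_tendsto (tendsto_pi_nhds.2 fun y =>
          hC.tendsto_RFunkPlus_sub hb y.2 (IsClosedPointedCone.tendsto_add_smul u b)) ?_
        filter_upwards [eventually_gt_atTop 0] with t ht
        exact ⟨⟨_, hmem u hu t ht⟩, rfl⟩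
  refine ⟨heq, fun h hh => ⟨fun hne => ?_, ?_⟩⟩
  · rw [heq] at hh
    rcases hh with h1 | ⟨u, hu, rfl⟩
    · exact Or.inl h1
    · refine Or.inr ⟨u, ⟨subset_closure hu, fun hui => hne ⟨u, hui⟩ ?_⟩, rfl⟩
      funext y
      exact neg_add_eq_sub _ _
  · rintro (⟨u, hu, hu0, rfl⟩ | ⟨u, hu, rfl⟩) z heqz
    · obtain ⟨x, hx, hlt⟩ := hC.exists_lt_RFunk_sub hb hu hu0 (RFunkPlus C b z.1)
      have h1 := congrFun heqz ⟨x, hx⟩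
      have h2 : 0 ≤ RFunkPlus C x z.1 := IsClosedPointedCone.RFunkPlus_nonneg
      dsimp only at h1
      linarith
    · refine hu.2 (hC.eq_of_RFunkPlus_eq_add (c := RFunkPlus C b u - RFunkPlus C b z.1)
        (hclosed.frontier_subset hu) z.2 (fun x hx => ?_) ▸ z.2)
      have h1 := congrFun heqz ⟨x, hx⟩
      dsimp only at h1
      linarith
end

section
/- Let 𝕋 = ℝ/ℤ be the circle with its canonical quotient metric d_𝕋, let X = 𝕋 × ℝ with the metric d((x,t),(x',t')) = d_𝕋(x,x') + |t − t'|, let α ∈ (0,1/2), and let T : X → X be defined by T(x,t) = (x + α, t + 1). Then T is non-expansive for d, the escape rate satisfies ρ(T) = lim_{k→∞} d((x,t), T^k(x,t))/k = 1 for every (x,t) ∈ X, while ρ̄(T) = inf_{z∈X} d(z, T(z)) = 1 + α; in particular ρ̄(T) > ρ(T). -/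
open Filter Topology

/-- The sum metric on `𝕋 × ℝ`: `d((x,t),(x',t')) = d_𝕋(x,x') + |t − t'|`. -/
noncomputable def torusDist (p q : AddCircle (1 : ℝ) × ℝ) : ℝ :=
  dist p.1 q.1 + |p.2 - q.2|

/-- The translation map `T(x,t) = (x + α, t + 1)` on `𝕋 × ℝ`. -/
noncomputable def torusShiftMap (α : ℝ) (p : AddCircle (1 : ℝ) × ℝ) : AddCircle (1 : ℝ) × ℝ :=
  (p.1 + (α : AddCircle (1 : ℝ)), p.2 + 1)

theorem torusDist_shiftMap_shiftMap (α : ℝ) (p q : AddCircle (1 : ℝ) × ℝ) :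
    torusDist (torusShiftMap α p) (torusShiftMap α q) = torusDist p q := by
  simp [torusDist, torusShiftMap]

theorem torusShiftMap_iterate (α : ℝ) (k : ℕ) (p : AddCircle (1 : ℝ) × ℝ) :
    (torusShiftMap α)^[k] p = (p.1 + k • (α : AddCircle (1 : ℝ)), p.2 + k) := by
  induction k with
  | zero => simp
  | succ k ih =>
    rw [Function.iterate_succ_apply', ih]
    simp only [torusShiftMap, succ_nsmul, Nat.cast_succ, add_assoc]

theorem torusDist_iterate (α : ℝ) (k : ℕ) (p : AddCircle (1 : ℝ) × ℝ) :
    torusDist p ((torusShiftMap α)^[k] p) = ‖k • (α : AddCircle (1 : ℝ))‖ + k := by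
  rw [torusShiftMap_iterate]
  simp [torusDist]

theorem torusDist_shiftMap {α : ℝ} (hα : |α| ≤ 1 / 2) (p : AddCircle (1 : ℝ) × ℝ) :
    torusDist p (torusShiftMap α p) = 1 + |α| := by
  have h : ‖(α : AddCircle (1 : ℝ))‖ = |α| :=
    (AddCircle.norm_coe_eq_abs_iff (p := 1) one_ne_zero).2 (by simpa using hα)
  simp [torusDist, torusShiftMap, h, add_comm]

theorem tendsto_torusDist_iterate_div (α : ℝ) (p : AddCircle (1 : ℝ) × ℝ) :
    Tendsto (fun k : ℕ => torusDist p ((torusShiftMap α)^[k] p) / (k : ℝ)) atTop (𝓝 1) := by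
  have h0 : Tendsto (fun k : ℕ => ‖k • (α : AddCircle (1 : ℝ))‖ / (k : ℝ)) atTop (𝓝 0) := by
    refine squeeze_zero (fun k => by positivity) (fun k => ?_)
      (tendsto_const_div_atTop_nhds_zero_nat (|(1 : ℝ)| / 2))
    gcongr
    exact AddCircle.norm_le_half_period 1 one_ne_zero
  have h1 := h0.add_const 1
  rw [zero_add] at h1
  refine h1.congr' ?_
  filter_upwards [eventually_ne_atTop 0] with k hk
  rw [torusDist_iterate, add_div, div_self (Nat.cast_ne_zero.2 hk)]

/-- On `X = 𝕋 × ℝ` (`𝕋 = ℝ/ℤ` with its canonical metric) with the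
sum metric `d((x,t),(x',t')) = d_𝕋(x,x') + |t − t'|`, the map
`T(x,t) = (x + α, t + 1)` (with `0 < α < 1/2`) is non-expansive, its escape rate
is `ρ(T) = lim_k d(p, T^k(p))/k = 1` for every `p`, while
`ρ̄(T) = inf_z d(z, T(z)) = 1 + α`; in particular `ρ̄(T) > ρ(T)`. -/
theorem torus_example (α : ℝ) (hα0 : 0 < α) (hα : α < 1 / 2) :
    (∀ p q : AddCircle (1 : ℝ) × ℝ,
        torusDist (torusShiftMap α p) (torusShiftMap α q) ≤ torusDist p q) ∧
    (∀ p : AddCircle (1 : ℝ) × ℝ,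
        Tendsto (fun k : ℕ => torusDist p ((torusShiftMap α)^[k] p) / (k : ℝ))
          atTop (𝓝 1)) ∧
    (⨅ p : AddCircle (1 : ℝ) × ℝ, torusDist p (torusShiftMap α p)) = 1 + α ∧
    (1 : ℝ) < 1 + α := by
  refine ⟨fun p q => (torusDist_shiftMap_shiftMap α p q).le,
    tendsto_torusDist_iterate_div α, ?_, by linarith⟩
  have hα' : |α| ≤ 1 / 2 := by rw [abs_of_pos hα0]; exact hα.le
  simp only [torusDist_shiftMap hα', ciInf_const, abs_of_pos hα0]
end

section
/- Let M be an n×n matrix with nonnegative real entries. Then inf over vectors y ∈ ℝⁿ with all entries positive of max_{1≤i≤n} (My)_i / y_i equals max over nonzero vectors u ∈ ℝⁿ with nonnegative entries of min over indices i with u_i ≠ 0 of (Mu)_i / u_i, and the outer maximum is attained. -/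
open Matrix

/-- A linear functional that is nonpositive on the open positive orthant is nonpositive on every
standard basis vector. -/
lemma apply_single_nonpos_of_forall_pos {n : ℕ} (g : (Fin n → ℝ) →ₗ[ℝ] ℝ)
    (hg : ∀ a : Fin n → ℝ, (∀ i, 0 < a i) → g a ≤ 0) (j : Fin n) : g (Pi.single j 1) ≤ 0 := by
  by_contra! h
  set e : Fin n → ℝ := Pi.single j 1
  have hd : 0 < |g 1| + 1 := by positivity
  set δ := g e / (|g 1| + 1) with hδ
  have hδ0 : 0 < δ := div_pos h hd
  have h1 := hg (e + δ • (1 : Fin n → ℝ)) fun i => by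
    have : 0 ≤ e i := by
      by_cases hij : i = j
      · subst hij; simp [e]
      · simp [e, hij]
    simp only [Pi.add_apply, Pi.smul_apply, Pi.one_apply, smul_eq_mul, mul_one]
    linarith
  rw [map_add, map_smul, smul_eq_mul] at h1
  have h2 : δ * (|g 1| + 1) = g e := div_mul_cancel₀ _ hd.ne'
  nlinarith [neg_abs_le (g 1)]

/-- A theorem of the alternative: if `B` maps no positive vector to a positive vector, then `Bᵀ`
maps some nonzero nonnegative vector to a nonpositive one. -/
lemma exists_nonneg_transpose_mulVec_nonpos {n : ℕ} (B : Matrix (Fin n) (Fin n) ℝ)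
    (hB : ∀ y : Fin n → ℝ, (∀ i, 0 < y i) → ∃ i, (B *ᵥ y) i ≤ 0) :
    ∃ u : Fin n → ℝ, (∀ i, 0 ≤ u i) ∧ u ≠ 0 ∧ ∀ i, (Bᵀ *ᵥ u) i ≤ 0 := by
  let P : Set (Fin n → ℝ) := Set.univ.pi fun _ => Set.Ioi 0
  have hP : ∀ a : Fin n → ℝ, a ∈ P ↔ ∀ i, 0 < a i := fun a => by simp [P]
  have hPo : IsOpen P := isOpen_set_pi Set.finite_univ fun _ _ => isOpen_Ioi
  have hPc : Convex ℝ P := convex_pi fun _ _ => convex_Ioi 0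
  have hdisj : Disjoint P (B.mulVecLin '' P) := by
    rw [Set.disjoint_left]
    rintro _ hb ⟨y, hy, rfl⟩
    obtain ⟨i, hi⟩ := hB y ((hP y).1 hy)
    exact absurd ((hP _).1 hb i) (not_lt.2 hi)
  obtain ⟨f, c, hfc, hcf⟩ :=
    geometric_hahn_banach_open hPc hPo (hPc.linear_image B.mulVecLin) hdisj
  have hsmul : ∀ a ∈ P, ∀ t : ℝ, 0 < t → t • a ∈ P := fun a ha t ht =>
    (hP _).2 fun i => mul_pos ht ((hP a).1 ha i)
  have hone : (1 : Fin n → ℝ) ∈ P := (hP _).2 fun _ => one_pos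
  have hfP : ∀ a ∈ P, f a ≤ 0 := fun a ha => by
    by_contra! h
    have h1 := hfc _ (hsmul a ha ((|c| + 1) / f a) (by positivity))
    rw [map_smul, smul_eq_mul, div_mul_cancel₀ _ h.ne'] at h1
    linarith [le_abs_self c]
  have hfB : ∀ y ∈ P, 0 ≤ f (B *ᵥ y) := fun y hy => by
    by_contra! h
    have h1 := hcf _ ⟨_, hsmul y hy ((|c| + 1) / -f (B *ᵥ y))
      (div_pos (by positivity) (neg_pos.2 h)), rfl⟩
    rw [mulVecLin_apply, mulVec_smul, map_smul, smul_eq_mul, div_mul_eq_mul_div,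
      div_neg, mul_div_cancel_right₀ _ h.ne] at h1
    linarith [neg_abs_le c]
  have hf : ∀ v : Fin n → ℝ, f v = ∑ i, v i * f (Pi.single i 1) := fun v => by
    conv_lhs => rw [pi_eq_sum_univ' v, map_sum]
    refine Finset.sum_congr rfl fun i _ => ?_
    rw [map_smul, smul_eq_mul]
  refine ⟨fun i => -f (Pi.single i 1), fun i => ?_, fun h0 => ?_, fun j => ?_⟩
  · exact neg_nonneg.2 <| apply_single_nonpos_of_forall_pos f.toLinearMap
      (fun a ha => hfP a ((hP a).2 ha)) i
  · have hz : ∀ v, f v = 0 := fun v => by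
      rw [hf]
      exact Finset.sum_eq_zero fun i _ => by
        rw [neg_eq_zero.1 (congrFun h0 i), mul_zero]
    have h1 := hfc _ hone
    have h2 := hcf _ ⟨_, hone, rfl⟩
    rw [hz] at h1 h2
    linarith
  · have h1 := apply_single_nonpos_of_forall_pos (-(f.toLinearMap ∘ₗ B.mulVecLin))
      (fun a ha => neg_nonpos.2 (hfB a ((hP a).2 ha))) j
    have h2 : 0 ≤ f (B *ᵥ Pi.single j 1) := neg_nonpos.1 h1
    rw [hf] at h2
    simpa [mulVec, dotProduct, Finset.sum_neg_distrib, Pi.single_apply] using h2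

/-- Subinvariance from below is dominated by subinvariance from above. -/
lemma le_of_smul_le_mulVec_of_mulVec_le_smul {n : ℕ} {M : Matrix (Fin n) (Fin n) ℝ}
    (hM : ∀ i j, 0 ≤ M i j) {u y : Fin n → ℝ} (hu : ∀ i, 0 ≤ u i) (hu0 : u ≠ 0)
    (hy : ∀ i, 0 < y i) {a b : ℝ} (ha : ∀ i, a * u i ≤ (M *ᵥ u) i)
    (hb : ∀ i, (M *ᵥ y) i ≤ b * y i) : a ≤ b := by
  obtain ⟨k, hk⟩ := Function.ne_iff.1 hu0
  have : Nonempty (Fin n) := ⟨k⟩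
  obtain ⟨m, hm⟩ := Finite.exists_max fun i => u i / y i
  set t := u m / y m with ht
  have ht0 : 0 < t := (div_pos ((hu k).lt_of_ne' hk) (hy k)).trans_le (hm k)
  have hum : u m = t * y m := (div_mul_cancel₀ _ (hy m).ne').symm
  have hle : ∀ i, u i ≤ t * y i := fun i => (div_le_iff₀ (hy i)).1 (hm i)
  have h1 : (M *ᵥ u) m ≤ t * (M *ᵥ y) m := by
    simp only [mulVec, dotProduct, Finset.mul_sum]
    refine Finset.sum_le_sum fun i _ => ?_
    rw [mul_left_comm]
    exact mul_le_mul_of_nonneg_left (hle i) (hM m i)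
  have h2 : a * u m ≤ b * u m := calc
    a * u m ≤ t * (M *ᵥ y) m := (ha m).trans h1
    _ ≤ t * (b * y m) := mul_le_mul_of_nonneg_left (hb m) ht0.le
    _ = b * u m := by rw [hum]; ring
  exact le_of_mul_le_mul_right h2 (hum ▸ mul_pos ht0 (hy m))

/-- The upper Collatz–Wielandt number `inf_{y > 0} max_i (My)_i / y_i`. -/
noncomputable def collatzWielandtUpper {n : ℕ} (M : Matrix (Fin n) (Fin n) ℝ) : ℝ :=
  sInf {r : ℝ | ∃ y : Fin n → ℝ, (∀ i, 0 < y i) ∧ r = ⨆ i : Fin n, M.mulVec y i / y i}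

lemma le_collatzWielandtUpper {n : ℕ} {M : Matrix (Fin n) (Fin n) ℝ}
    (hM : ∀ i j, 0 ≤ M i j) {u : Fin n → ℝ} (hu : ∀ i, 0 ≤ u i) (hu0 : u ≠ 0) {a : ℝ}
    (ha : ∀ i, a * u i ≤ (M *ᵥ u) i) : a ≤ collatzWielandtUpper M := by
  refine le_csInf ⟨_, 1, fun _ => one_pos, rfl⟩ ?_
  rintro _ ⟨y, hy, rfl⟩
  exact le_of_smul_le_mulVec_of_mulVec_le_smul hM hu hu0 hy ha fun i =>
    (div_le_iff₀ (hy i)).1 (le_ciSup (f := fun i => (M *ᵥ y) i / y i)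
      (Set.finite_range _).bddAbove i)

lemma mulVec_nonneg_of_nonneg {n : ℕ} {M : Matrix (Fin n) (Fin n) ℝ}
    (hM : ∀ i j, 0 ≤ M i j) {u : Fin n → ℝ} (hu : ∀ i, 0 ≤ u i) (i : Fin n) :
    0 ≤ (M *ᵥ u) i :=
  dotProduct_nonneg_of_nonneg (hM i) hu

lemma exists_collatzWielandtUpper_smul_le_transpose_mulVec {n : ℕ} (hn : 0 < n)
    {M : Matrix (Fin n) (Fin n) ℝ} (hM : ∀ i j, 0 ≤ M i j) :
    ∃ u : Fin n → ℝ, (∀ i, 0 ≤ u i) ∧ u ≠ 0 ∧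
      ∀ i, collatzWielandtUpper M * u i ≤ (Mᵀ *ᵥ u) i := by
  have : Nonempty (Fin n) := ⟨⟨0, hn⟩⟩
  obtain ⟨u, hu, hu0, h⟩ := exists_nonneg_transpose_mulVec_nonpos
    (collatzWielandtUpper M • (1 : Matrix (Fin n) (Fin n) ℝ) - M) fun y hy => by
      obtain ⟨i, hi⟩ := exists_eq_ciSup_of_finite (f := fun i => (M *ᵥ y) i / y i)
      have hle : collatzWielandtUpper M ≤ (M *ᵥ y) i / y i := by
        refine csInf_le ⟨0, ?_⟩ ⟨y, hy, hi⟩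
        rintro _ ⟨z, hz, rfl⟩
        exact Real.iSup_nonneg fun j =>
          div_nonneg (mulVec_nonneg_of_nonneg hM (fun k => (hz k).le) j) (hz j).le
      refine ⟨i, ?_⟩
      simpa [sub_mulVec, smul_mulVec] using (le_div_iff₀ (hy i)).1 hle
  refine ⟨u, hu, hu0, fun i => ?_⟩
  simpa [sub_mulVec, smul_mulVec] using h i

lemma collatzWielandtUpper_le_transpose {n : ℕ} (hn : 0 < n)
    {M : Matrix (Fin n) (Fin n) ℝ} (hM : ∀ i j, 0 ≤ M i j) :
    collatzWielandtUpper M ≤ collatzWielandtUpper Mᵀ := by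
  obtain ⟨u, hu, hu0, h⟩ := exists_collatzWielandtUpper_smul_le_transpose_mulVec hn hM
  exact le_collatzWielandtUpper (fun i j => hM j i) hu hu0 h

lemma iInf_support_mul_le_mulVec {n : ℕ} {M : Matrix (Fin n) (Fin n) ℝ}
    (hM : ∀ i j, 0 ≤ M i j) {u : Fin n → ℝ} (hu : ∀ i, 0 ≤ u i) (i : Fin n) :
    (⨅ i : {i : Fin n // u i ≠ 0}, M.mulVec u i / u i) * u i ≤ (M *ᵥ u) i := by
  by_cases hi : u i = 0
  · rw [hi, mul_zero]
    exact mulVec_nonneg_of_nonneg hM hu i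
  · exact (le_div_iff₀ ((hu i).lt_of_ne' hi)).1 <|
      ciInf_le (f := fun i : {i : Fin n // u i ≠ 0} => (M *ᵥ u) i / u i)
        (Set.finite_range _).bddBelow ⟨i, hi⟩


/-- Collatz–Wielandt: Let `M` be an `n × n` matrix with
non-negative real entries (`n ≥ 1`).  Then
`inf_{y > 0} max_i (My)_i / y_i = max_{0 ≠ u ≥ 0} min_{i : u_i ≠ 0} (Mu)_i / u_i`,
and the maximum on the right-hand side is attained. -/
theorem collatz_wielandt {n : ℕ} (hn : 0 < n)
    (M : Matrix (Fin n) (Fin n) ℝ) (hM : ∀ i j, 0 ≤ M i j) :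
    ∃ ρ : ℝ,
      IsGreatest {r : ℝ | ∃ u : Fin n → ℝ, (∀ i, 0 ≤ u i) ∧ u ≠ 0 ∧
          r = ⨅ i : {i : Fin n // u i ≠ 0}, M.mulVec u i / u i} ρ ∧
      sInf {r : ℝ | ∃ y : Fin n → ℝ, (∀ i, 0 < y i) ∧
          r = ⨆ i : Fin n, M.mulVec y i / y i} = ρ := by
  refine ⟨collatzWielandtUpper M, ⟨?_, ?_⟩, rfl⟩
  · obtain ⟨u, hu, hu0, h⟩ :=
      exists_collatzWielandtUpper_smul_le_transpose_mulVec hn (M := Mᵀ) fun i j => hM j i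
    rw [transpose_transpose] at h
    refine ⟨u, hu, hu0, le_antisymm ?_ ?_⟩
    · obtain ⟨k, hk⟩ := Function.ne_iff.1 hu0
      have : Nonempty {i : Fin n // u i ≠ 0} := ⟨⟨k, hk⟩⟩
      refine (collatzWielandtUpper_le_transpose hn hM).trans (le_ciInf fun i => ?_)
      exact (le_div_iff₀ ((hu i).lt_of_ne' i.2)).2 (h i)
    · exact le_collatzWielandtUpper hM hu hu0 (iInf_support_mul_le_mulVec hM hu)
  · rintro _ ⟨u, hu, hu0, rfl⟩
    exact le_collatzWielandtUpper hM hu hu0 (iInf_support_mul_le_mulVec hM hu)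
end
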